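/- If G is a finite simple graph with girth at least 9, then m(G) - 1 ≤ χ_b(G) ≤ m(G); that is, the b-chromatic number of G equals either m(G) or m(G) - 1. -/

import Mathlib

open SimpleGraph Finset

/-- A vertex `u` is a b-vertex for the coloring `C` if `u` has a neighbor colored
with each color different from its own. -/
def IsBVertex {V : Type*} (G : SimpleGraph V) {k : ℕ} (C : V → Fin k) (u : V) : Prop :=
  ∀ j : Fin k, j ≠ C u → ∃ w, G.Adj u w ∧ C w = j

/-- A b-coloring of `G` with `k` colors: a proper coloring with colors `Fin k` such that
every color class contains a b-vertex (in particular every color is used). -/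
def IsBColoring {V : Type*} (G : SimpleGraph V) (k : ℕ) (C : V → Fin k) : Prop :=
  (∀ u v, G.Adj u v → C u ≠ C v) ∧
  (∀ i : Fin k, ∃ u, C u = i ∧ IsBVertex G C u)

/-- The b-chromatic number: the largest `k` such that `G` has a b-coloring with `k` colors. -/
noncomputable def bChromatic {V : Type*} (G : SimpleGraph V) : ℕ :=
  sSup {k : ℕ | ∃ C : V → Fin k, IsBColoring G k C}

/-- `m(G)`: the largest `k` such that `G` has at least `k` vertices of degree at least `k - 1`. -/
noncomputable def mParam {V : Type*} [Fintype V] (G : SimpleGraph V) [DecidableRel G.Adj] : ℕ :=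
  sSup {k : ℕ | k ≤ (Finset.univ.filter fun v => k - 1 ≤ G.degree v).card}

/-- The set `M(G)` of dense vertices, i.e. vertices of degree at least `m(G) - 1`. -/
noncomputable def denseSet {V : Type*} [Fintype V] (G : SimpleGraph V) [DecidableRel G.Adj] :
    Finset V :=
  Finset.univ.filter fun v => mParam G - 1 ≤ G.degree v

/-- `W` encircles `u` if every `v ∈ W` is adjacent to `u` or has a common neighbor
`w ∈ W` with `u` such that `deg w = m(G) - 1`. -/
def Encircles {V : Type*} [Fintype V] (G : SimpleGraph V) [DecidableRel G.Adj]
    (W : Finset V) (u : V) : Prop :=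
  ∀ v ∈ W, G.Adj u v ∨ ∃ w ∈ W, G.Adj v w ∧ G.Adj u w ∧ G.degree w = mParam G - 1

/-- A good set: a set `W ⊆ M(G)` of `m(G)` vertices that encircles no vertex outside `W`,
and such that every vertex outside `W` of degree at least `m(G)` has a neighbor in `W`. -/
def IsGoodSet {V : Type*} [Fintype V] (G : SimpleGraph V) [DecidableRel G.Adj]
    (W : Finset V) : Prop :=
  W.card = mParam G ∧
  (∀ v ∈ W, mParam G - 1 ≤ G.degree v) ∧
  (∀ u, u ∉ W → ¬ Encircles G W u) ∧
  (∀ x, x ∉ W → mParam G ≤ G.degree x → ∃ w ∈ W, G.Adj x w)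

section ShortCycles

variable {V : Type*} {G : SimpleGraph V}

/-- In a graph of girth at least nine, two paths with the same ends and total length at most
eight coincide. -/
theorem path_unique_of_nine_le_egirth (hg : 9 ≤ G.egirth) {u v : V} {p q : G.Walk u v}
    (hp : p.IsPath) (hq : q.IsPath) (hpq : p.length + q.length ≤ 8) : p = q := by
  classical
  let H : SimpleGraph V := SimpleGraph.fromEdgeSet {e | e ∈ p.edges ∨ e ∈ q.edges}
  have hHG : H ≤ G := by
    intro a b hab
    rw [SimpleGraph.fromEdgeSet_adj] at hab
    rcases hab.1 with h | h
    · exact p.adj_of_mem_edges h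
    · exact q.adj_of_mem_edges h
  have hH : H.IsAcyclic := by
    intro a r hr
    have hcyc : (r.mapLe hHG).IsCycle := hr.mapLe hHG
    have h9 : (9 : ℕ∞) ≤ (r.mapLe hHG).length := hg.trans hcyc.egirth_le_length
    have h9' : 9 ≤ r.length := by
      rw [SimpleGraph.Walk.length_map] at h9
      exact_mod_cast h9
    have hsub : r.edges ⊆ p.edges ++ q.edges := by
      intro e he
      have := r.edges_subset_edgeSet he
      rw [SimpleGraph.edgeSet_fromEdgeSet] at this
      simpa using this.1
    have hle := (hr.edges_nodup.subperm hsub).length_le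
    simp only [List.length_append, SimpleGraph.Walk.length_edges] at hle
    omega
  have hpH : ∀ e ∈ p.edges, e ∈ H.edgeSet := by
    intro e he
    rw [SimpleGraph.edgeSet_fromEdgeSet]
    exact ⟨Or.inl he, G.not_isDiag_of_mem_edgeSet (p.edges_subset_edgeSet he)⟩
  have hqH : ∀ e ∈ q.edges, e ∈ H.edgeSet := by
    intro e he
    rw [SimpleGraph.edgeSet_fromEdgeSet]
    exact ⟨Or.inr he, G.not_isDiag_of_mem_edgeSet (q.edges_subset_edgeSet he)⟩
  have h := (hH.subsingleton_path u v).elim ⟨p.transfer H hpH, hp.transfer hpH⟩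
    ⟨q.transfer H hqH, hq.transfer hqH⟩
  have h' : p.transfer H hpH = q.transfer H hqH := congrArg Subtype.val h
  apply SimpleGraph.Walk.ext_support
  rw [← SimpleGraph.Walk.support_transfer p hpH, h', SimpleGraph.Walk.support_transfer]

theorem exists_walk_of_forall_adj (p : ℕ → V) (n : ℕ) (h : ∀ i < n, G.Adj (p i) (p (i + 1))) :
    ∃ w : G.Walk (p 0) (p n), w.length = n ∧ w.support = (List.range (n + 1)).map p := by
  induction n with
  | zero => exact ⟨.nil, rfl, by simp⟩
  | succ n ih =>
    obtain ⟨w, hl, hs⟩ := ih fun i hi => h i (by omega)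
    refine ⟨w.concat (h n (by omega)), by simp [hl], ?_⟩
    rw [SimpleGraph.Walk.support_concat, hs, List.range_succ (n := n + 1)]
    simp

/-- A non-backtracking walk of length between one and eight is not closed. -/
theorem ne_of_nonbacktracking (hg : 9 ≤ G.egirth) (n : ℕ) : ∀ p : ℕ → V, 1 ≤ n → n ≤ 8 →
    (∀ i < n, G.Adj (p i) (p (i + 1))) → (∀ i, i + 2 ≤ n → p i ≠ p (i + 2)) → p 0 ≠ p n := by
  induction n using Nat.strong_induction_on with
  | _ n ih =>
    intro p h1 h8 hadj hnb h0
    have hne : ∀ i j, i < j → j ≤ n → j - i < n → p i ≠ p j := by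
      intro i j hij hj hlt
      have := ih (j - i) hlt (fun t => p (i + t)) (by omega) (by omega)
        (fun t ht => hadj (i + t) (by omega)) (fun t ht => hnb (i + t) (by omega))
      simpa [Nat.add_sub_cancel' hij.le] using this
    have hn3 : 3 ≤ n := by
      by_contra hlt
      obtain rfl | rfl : n = 1 ∨ n = 2 := by omega
      · exact (hadj 0 (by omega)).ne h0
      · exact hnb 0 (by omega) h0
    obtain ⟨m, rfl⟩ : ∃ m, n = m + 1 := ⟨n - 1, by omega⟩
    obtain ⟨w, hl, hs⟩ := exists_walk_of_forall_adj (G := G) (fun t => p (t + 1)) m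
      (fun i hi => hadj (i + 1) (by omega))
    have hw : w.IsPath := by
      rw [SimpleGraph.Walk.isPath_def, hs]
      refine List.Nodup.map_on ?_ List.nodup_range
      intro x hx y hy hxy
      simp only [List.mem_range] at hx hy
      by_contra hxy'
      rcases lt_or_gt_of_ne hxy' with hlt | hlt
      · exact hne (x + 1) (y + 1) (by omega) (by omega) (by omega) hxy
      · exact hne (y + 1) (x + 1) (by omega) (by omega) (by omega) hxy.symm
    have hedge : G.Adj (p (0 + 1)) (p (m + 1)) := by
      rw [← h0]
      exact (hadj 0 (by omega)).symm
    have heq := path_unique_of_nine_le_egirth hg hw (SimpleGraph.Walk.IsPath.of_adj hedge)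
      (by simp [hl]; omega)
    have := congrArg SimpleGraph.Walk.length heq
    simp only [hl, SimpleGraph.Walk.length_cons, SimpleGraph.Walk.length_nil] at this
    omega

theorem false_of_closed_three (hg : 9 ≤ G.egirth) {a b c : V}
    (h₁ : G.Adj a b) (h₂ : G.Adj b c) (h₃ : G.Adj c a) : False := by
  refine ne_of_nonbacktracking hg 3 (fun i => [a, b, c, a].getD i a) (by simp) (by simp) ?_ ?_ rfl
  · intro i hi
    interval_cases i <;> simpa
  · intro i hi
    have hi' : i ≤ 1 := by omega
    interval_cases i
    · simpa using h₃.ne'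
    · simpa using h₁.ne'

theorem false_of_closed_four (hg : 9 ≤ G.egirth) {a b c d : V}
    (h₁ : G.Adj a b) (h₂ : G.Adj b c) (h₃ : G.Adj c d) (h₄ : G.Adj d a)
    (n₁ : a ≠ c) (n₂ : b ≠ d) : False := by
  refine ne_of_nonbacktracking hg 4 (fun i => [a, b, c, d, a].getD i a)
    (by simp) (by simp) ?_ ?_ rfl
  · intro i hi
    interval_cases i <;> simpa
  · intro i hi
    have hi' : i ≤ 2 := by omega
    interval_cases i
    · simpa using n₁
    · simpa using n₂
    · simpa using n₁.symm

theorem false_of_closed_five (hg : 9 ≤ G.egirth) {a b c d e : V}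
    (h₁ : G.Adj a b) (h₂ : G.Adj b c) (h₃ : G.Adj c d) (h₄ : G.Adj d e) (h₅ : G.Adj e a)
    (n₁ : a ≠ c) (n₂ : b ≠ d) (n₃ : c ≠ e) (n₄ : d ≠ a) : False := by
  refine ne_of_nonbacktracking hg 5 (fun i => [a, b, c, d, e, a].getD i a)
    (by simp) (by simp) ?_ ?_ rfl
  · intro i hi
    interval_cases i <;> simpa
  · intro i hi
    have hi' : i ≤ 3 := by omega
    interval_cases i
    · simpa using n₁
    · simpa using n₂
    · simpa using n₃
    · simpa using n₄

theorem false_of_closed_six (hg : 9 ≤ G.egirth) {a b c d e f : V}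
    (h₁ : G.Adj a b) (h₂ : G.Adj b c) (h₃ : G.Adj c d) (h₄ : G.Adj d e)
    (h₅ : G.Adj e f) (h₆ : G.Adj f a)
    (n₁ : a ≠ c) (n₂ : b ≠ d) (n₃ : c ≠ e) (n₄ : d ≠ f) (n₅ : e ≠ a) : False := by
  refine ne_of_nonbacktracking hg 6 (fun i => [a, b, c, d, e, f, a].getD i a)
    (by simp) (by simp) ?_ ?_ rfl
  · intro i hi
    interval_cases i <;> simpa
  · intro i hi
    have hi' : i ≤ 4 := by omega
    interval_cases i
    · simpa using n₁
    · simpa using n₂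
    · simpa using n₃
    · simpa using n₄
    · simpa using n₅

theorem false_of_closed_seven (hg : 9 ≤ G.egirth) {a b c d e f g : V}
    (h₁ : G.Adj a b) (h₂ : G.Adj b c) (h₃ : G.Adj c d) (h₄ : G.Adj d e)
    (h₅ : G.Adj e f) (h₆ : G.Adj f g) (h₇ : G.Adj g a)
    (n₁ : a ≠ c) (n₂ : b ≠ d) (n₃ : c ≠ e) (n₄ : d ≠ f) (n₅ : e ≠ g) (n₆ : f ≠ a) : False := by
  refine ne_of_nonbacktracking hg 7 (fun i => [a, b, c, d, e, f, g, a].getD i a)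
    (by simp) (by simp) ?_ ?_ rfl
  · intro i hi
    interval_cases i <;> simpa
  · intro i hi
    have hi' : i ≤ 5 := by omega
    interval_cases i
    · simpa using n₁
    · simpa using n₂
    · simpa using n₃
    · simpa using n₄
    · simpa using n₅
    · simpa using n₆

theorem false_of_closed_eight (hg : 9 ≤ G.egirth) {a b c d e f g h : V}
    (h₁ : G.Adj a b) (h₂ : G.Adj b c) (h₃ : G.Adj c d) (h₄ : G.Adj d e)
    (h₅ : G.Adj e f) (h₆ : G.Adj f g) (h₇ : G.Adj g h) (h₈ : G.Adj h a)
    (n₁ : a ≠ c) (n₂ : b ≠ d) (n₃ : c ≠ e) (n₄ : d ≠ f) (n₅ : e ≠ g) (n₆ : f ≠ h)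
    (n₇ : g ≠ a) : False := by
  refine ne_of_nonbacktracking hg 8 (fun i => [a, b, c, d, e, f, g, h, a].getD i a)
    (by simp) (by simp) ?_ ?_ rfl
  · intro i hi
    interval_cases i <;> simpa
  · intro i hi
    have hi' : i ≤ 6 := by omega
    interval_cases i
    · simpa using n₁
    · simpa using n₂
    · simpa using n₃
    · simpa using n₄
    · simpa using n₅
    · simpa using n₆
    · simpa using n₇

theorem eq_of_common_neighbors (hg : 9 ≤ G.egirth) {a b c d : V} (h₁ : G.Adj a b)
    (h₂ : G.Adj b c) (h₃ : G.Adj a d) (h₄ : G.Adj d c) (h : a ≠ c) : b = d := by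
  by_contra hbd
  exact false_of_closed_four hg h₁ h₂ h₄.symm h₃.symm h hbd

end ShortCycles

section Extension

variable {V : Type*}

/-- The coloring `c` is proper on the set of vertices `s`. -/
def ProperOn (G : SimpleGraph V) {k : ℕ} (c : V → Fin k) (s : Finset V) : Prop :=
  ∀ u ∈ s, ∀ v ∈ s, G.Adj u v → c u ≠ c v

/-- Every coloring that is proper outside `Y` and gives `a` and `b` the same color can be
recolored on `Y` to become proper. -/
def Extendable [Fintype V] [DecidableEq V] (G : SimpleGraph V) (k : ℕ) (a b : V)
    (Y : Finset V) : Prop :=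
  ∀ c : V → Fin k, ProperOn G c Yᶜ → c a = c b →
    ∃ c' : V → Fin k, ProperOn G c' Finset.univ ∧ ∀ v ∉ Y, c' v = c v

variable {G : SimpleGraph V} {k : ℕ} {a b v z : V} {X Y : Finset V}

theorem ProperOn.mono {c : V → Fin k} {s t : Finset V} (hc : ProperOn G c t) (hst : s ⊆ t) :
    ProperOn G c s :=
  fun u hu v hv => hc u (hst hu) v (hst hv)

theorem ProperOn.update [DecidableEq V] {c : V → Fin k} {s : Finset V} {α : Fin k}
    (hc : ProperOn G c s)
    (hα : ∀ u ∈ s, G.Adj v u → c u ≠ α) :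
    ProperOn G (Function.update c v α) (insert v s) := by
  intro x hx y hy hxy
  rcases eq_or_ne x v with rfl | hxv <;> rcases eq_or_ne y x with rfl | hyx
  · exact absurd hxy (G.irrefl)
  · have hys := Finset.mem_of_mem_insert_of_ne hy hyx
    simpa [Function.update_of_ne hyx] using (hα y hys hxy).symm
  · exact absurd hxy (G.irrefl)
  · have hxs := Finset.mem_of_mem_insert_of_ne hx hxv
    rcases eq_or_ne y v with rfl | hyv
    · simpa [Function.update_of_ne hxv] using hα x hxs hxy.symm
    · have hys := Finset.mem_of_mem_insert_of_ne hy hyv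
      simpa [Function.update_of_ne hxv, Function.update_of_ne hyv] using hc x hxs y hys hxy

variable [Fintype V] [DecidableEq V]

theorem Extendable.of_forall {Y : Finset V} (h : Extendable G k v v Y) (a b : V) :
    Extendable G k a b Y :=
  fun c hc _ => h c hc rfl

theorem extendable_empty : Extendable G k a b ∅ :=
  fun c hc _ => ⟨c, by simpa using hc, fun _ _ => rfl⟩

variable [DecidableRel G.Adj]

theorem Extendable.insert_of_card_lt (h : Extendable G k a b Y) (hv' : a = b ∨ v ≠ a ∧ v ≠ b)
    (hv : ∀ c : V → Fin k, c a = c b → ((G.neighborFinset v \ Y).image c).card < k) :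
    Extendable G k a b (insert v Y) := by
  by_cases hvY : v ∈ Y
  · rwa [Finset.insert_eq_of_mem hvY]
  intro c hc hab
  obtain ⟨α, hα⟩ : ∃ α, α ∉ (G.neighborFinset v \ Y).image c := by
    by_contra! hall
    have := Finset.card_le_card (fun x _ => hall x : (Finset.univ : Finset (Fin k)) ⊆ _)
    rw [Finset.card_univ, Fintype.card_fin] at this
    exact absurd (hv c hab) (by omega)
  have hY : insert v (insert v Y)ᶜ = Yᶜ := by
    ext x
    by_cases hx : x = v <;> simp [hx, hvY]
  have hp : ProperOn G (Function.update c v α) Yᶜ := by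
    rw [← hY]
    refine hc.update fun u hu huv hcu => hα ?_
    simp only [Finset.mem_compl, Finset.mem_insert, not_or] at hu
    exact Finset.mem_image.2 ⟨u, by simp [huv, hu.2], hcu⟩
  obtain ⟨c', hc', hag⟩ := h _ hp (by
    rcases hv' with rfl | ⟨ha, hb⟩
    · rfl
    · rw [Function.update_of_ne ha.symm, Function.update_of_ne hb.symm, hab])
  refine ⟨c', hc', fun x hx => ?_⟩
  simp only [Finset.mem_insert, not_or] at hx
  rw [hag x hx.2, Function.update_of_ne hx.1]

theorem Extendable.insert_of_adj (h : Extendable G k a b Y) (hv' : a = b ∨ v ≠ a ∧ v ≠ b)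
    (hz : z ∈ Y) (hvz : G.Adj v z) (hk : G.degree v ≤ k) : Extendable G k a b (insert v Y) := by
  refine h.insert_of_card_lt hv' fun c _ => ?_
  calc _ ≤ (G.neighborFinset v \ Y).card := Finset.card_image_le
    _ < (G.neighborFinset v).card := Finset.card_lt_card <| by
        refine ⟨Finset.sdiff_subset, fun hsub => ?_⟩
        have := hsub ((G.mem_neighborFinset v z).2 hvz)
        simp [hz] at this
    _ ≤ k := hk

theorem Extendable.insert_of_degree_lt (h : Extendable G k a b Y) (hv' : a = b ∨ v ≠ a ∧ v ≠ b)
    (hk : G.degree v < k) : Extendable G k a b (insert v Y) := by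
  refine h.insert_of_card_lt hv' fun c _ => ?_
  calc _ ≤ (G.neighborFinset v \ Y).card := Finset.card_image_le
    _ ≤ (G.neighborFinset v).card := Finset.card_le_card Finset.sdiff_subset
    _ < k := hk

theorem Extendable.insert_of_twins (h : Extendable G k a b Y) (hva : G.Adj v a) (hvb : G.Adj v b)
    (hab : a ≠ b) (hk : G.degree v ≤ k) : Extendable G k a b (insert v Y) := by
  refine h.insert_of_card_lt (Or.inr ⟨hva.ne, hvb.ne⟩) fun c hc => ?_
  have hsub : (G.neighborFinset v \ Y).image c ⊆ ((G.neighborFinset v).erase a).image c := by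
    intro x hx
    obtain ⟨y, hy, rfl⟩ := Finset.mem_image.1 hx
    have hy' := (Finset.mem_sdiff.1 hy).1
    rcases eq_or_ne y a with rfl | hya
    · exact Finset.mem_image.2 ⟨b, by simp [hab.symm, hvb], hc.symm⟩
    · exact Finset.mem_image.2 ⟨y, by simpa [hya] using hy', rfl⟩
  calc _ ≤ (((G.neighborFinset v).erase a).image c).card := Finset.card_le_card hsub
    _ ≤ ((G.neighborFinset v).erase a).card := Finset.card_image_le
    _ < (G.neighborFinset v).card := Finset.card_erase_lt_of_mem (by simpa using hva)
    _ ≤ k := hk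

/-- Extendability spreads from `Y` to `X` along edges. -/
theorem Extendable.closure (h : Extendable G k a b Y) (hYX : Y ⊆ X) (ha : a ∉ X) (hb : b ∉ X)
    (hdeg : ∀ x ∈ X, x ∉ Y → G.degree x ≤ k)
    (hX : ∀ Z, Y ⊆ Z → Z ⊆ X → (∀ x ∈ X, ∀ z ∈ Z, G.Adj x z → x ∈ Z) → X ⊆ Z) :
    Extendable G k a b X := by
  classical
  obtain ⟨Z, hZ, hmax⟩ := Finset.exists_max_image
    (X.powerset.filter fun Z => Y ⊆ Z ∧ Extendable G k a b Z) Finset.card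
    ⟨Y, by simp [hYX, h]⟩
  simp only [Finset.mem_filter, Finset.mem_powerset] at hZ hmax
  obtain ⟨hZX, hYZ, hZe⟩ := hZ
  have hsub := hX Z hYZ hZX fun x hx z hz hxz => by
    by_contra hxZ
    have := hmax (insert x Z) ⟨Finset.insert_subset hx hZX, hYZ.trans (Finset.subset_insert _ _),
      hZe.insert_of_adj (Or.inr ⟨fun e => ha (e ▸ hx), fun e => hb (e ▸ hx)⟩) hz hxz
        (hdeg x hx fun h => hxZ (hYZ h))⟩
    rw [Finset.card_insert_of_notMem hxZ] at this
    omega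
  rwa [hsub.antisymm hZX]

end Extension

section ChordedCycle

variable {V : Type*} [Fintype V] [DecidableEq V] {G : SimpleGraph V} [DecidableRel G.Adj] {k : ℕ}

/-- A cycle `p 0, …, p n` with a chord from `p 0` to `p i`. -/
structure IsChordedCycle (G : SimpleGraph V) (p : ℕ → V) (n i : ℕ) : Prop where
  inj : Set.InjOn p (Set.Iic n)
  adj : ∀ j < n, G.Adj (p j) (p (j + 1))
  closes : G.Adj (p 0) (p n)
  one_lt : 1 < i
  lt : i < n
  chord : G.Adj (p 0) (p i)

theorem Extendable.union_chordedCycle (hg : 9 ≤ G.egirth) {p : ℕ → V} {n i : ℕ}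
    (hp : IsChordedCycle G p n i) {Y : Finset V} {v : V} (hY : Extendable G k v v Y)
    (hdisj : ∀ j ≤ n, p j ∉ Y) (hdeg : ∀ j ≤ n, G.degree (p j) ≤ k) :
    Extendable G k v v (Y ∪ (Finset.range (n + 1)).image p) := by
  obtain ⟨hinj, hadj, hcl, h1i, hin, hch⟩ := hp
  have hne : ∀ s t, s ≤ n → t ≤ n → s ≠ t → p s ≠ p t := fun s t hs ht hst h =>
    hst (hinj hs ht h)
  set X := Y ∪ (Finset.range (n + 1)).image p with hXdef
  have hpX : ∀ j ≤ n, p j ∈ X := fun j hj => by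
    rw [hXdef, Finset.mem_union, Finset.mem_image]
    exact Or.inr ⟨j, by simpa [Nat.lt_succ_iff] using hj, rfl⟩
  have hXcases : ∀ x ∈ X, x ∈ Y ∨ ∃ j ≤ n, p j = x := fun x hx => by
    rw [hXdef, Finset.mem_union, Finset.mem_image] at hx
    rcases hx with hx | ⟨j, hj, rfl⟩
    · exact Or.inl hx
    · exact Or.inr ⟨j, by simpa [Nat.lt_succ_iff] using hj, rfl⟩
  have hYX : Y ⊆ X := Finset.subset_union_left
  intro c hc _
  have hfree : ∃ α, α ∉ (G.neighborFinset (p 1) \ X).image c := by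
    by_contra! hall
    have h1 := Finset.card_le_card (fun x _ => hall x : (Finset.univ : Finset (Fin k)) ⊆ _)
    rw [Finset.card_univ, Fintype.card_fin] at h1
    have h2 : G.neighborFinset (p 1) \ X ⊂ G.neighborFinset (p 1) := by
      refine ⟨Finset.sdiff_subset, fun hsub => ?_⟩
      have := hsub ((G.mem_neighborFinset _ _).2 (hadj 0 (by omega)).symm)
      simp [hpX 0 (by omega)] at this
    have h3 := Finset.card_lt_card h2
    have h4 := Finset.card_image_le (s := G.neighborFinset (p 1) \ X) (f := c)
    have h5 := hdeg 1 (by omega)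
    rw [G.card_neighborFinset_eq_degree] at h3
    omega
  have hnotin : ∀ {w : V} {α : Fin k}, α ∉ (G.neighborFinset w \ X).image c →
      ∀ u ∈ Xᶜ, G.Adj w u → c u ≠ α := fun {w α} h u hu hwu hcu =>
    h (Finset.mem_image.2 ⟨u, by simpa [hwu] using hu, hcu⟩)
  obtain ⟨α, hα⟩ := hfree
  have hset : ∀ w ∈ X, insert w Xᶜ = (X.erase w)ᶜ := fun w hw => by
    ext x
    by_cases hx : x = w <;> simp [hx, hw]
  have hdegX : ∀ {Z : Finset V}, Z ⊆ X → ∀ w, ∀ x ∈ Z, x ∉ insert w Y → G.degree x ≤ k :=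
    fun hZ w x hx hxY => by
      rcases hXcases x (hZ hx) with h | ⟨j, hj, rfl⟩
      · exact absurd (Finset.mem_insert_of_mem h) hxY
      · exact hdeg j hj
  have hinsert : ∀ j ≤ n, ∀ {Z : Finset V}, p j ∈ Z → Y ⊆ Z → insert (p j) Y ⊆ Z :=
    fun j hj Z hj' hZ => Finset.insert_subset hj' hZ
  have hdown : ∀ {Z : Finset V} (m l : ℕ), l ≤ n → p l ∈ Z →
      (∀ j, m ≤ j → j < l → p (j + 1) ∈ Z → p j ∈ Z) → ∀ j, m ≤ j → j ≤ l → p j ∈ Z :=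
    fun {Z} m l hl hlZ hstep j hmj hjl =>
      Nat.decreasingInduction' (P := fun j => p j ∈ Z)
        (fun t htl hjt => hstep t (by omega) (by omega)) hjl hlZ
  have hup : ∀ {Z : Finset V} (m l : ℕ), p m ∈ Z →
      (∀ j, m ≤ j → j < l → p j ∈ Z → p (j + 1) ∈ Z) → ∀ j, m ≤ j → j ≤ l → p j ∈ Z :=
    fun {Z} m l hmZ hstep j hmj => by
      induction j, hmj using Nat.le_induction with
      | base => exact fun _ => hmZ
      | succ j hmj ih => exact fun hj => hstep j hmj (by omega) (ih (by omega))
  have hp0 := hpX 0 (by omega)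
  have hp1 := hpX 1 (by omega)
  have hpn := hpX n le_rfl
  have h1n : ¬ G.Adj (p n) (p 1) := fun h =>
    false_of_closed_three hg (hadj 0 (by omega)) h.symm hcl.symm
  have hagree : ∀ {Z : Finset V} {c₁ : V → Fin k}, Z ⊆ X → ProperOn G c₁ Zᶜ →
      (∃ a b, Extendable G k a b Z ∧ c₁ a = c₁ b) → (∀ x ∉ X, c₁ x = c x) →
      ∃ c' : V → Fin k, ProperOn G c' Finset.univ ∧ ∀ v ∉ X, c' v = c v :=
    fun hZ hp ⟨a, b, he, hab⟩ hc₁ => by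
      obtain ⟨c', hc', hag⟩ := he _ hp hab
      exact ⟨c', hc', fun x hx => by rw [hag x fun h => hx (hZ h), hc₁ x hx]⟩
  by_cases hcase : α ∈ (G.neighborFinset (p n) \ X).image c
  · obtain ⟨b₀, hb₀, hcb₀⟩ := Finset.mem_image.1 hcase
    simp only [Finset.mem_sdiff, SimpleGraph.mem_neighborFinset] at hb₀
    by_cases hcase' : α ∈ (G.neighborFinset (p 0) \ X).image c
    · obtain ⟨b, hb, hcb⟩ := Finset.mem_image.1 hcase'
      simp only [Finset.mem_sdiff, SimpleGraph.mem_neighborFinset] at hb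
      have hb1 : b ≠ p 1 := fun h => hb.2 (h ▸ hp1)
      refine hagree (Z := X.erase (p 1)) (Finset.erase_subset _ _)
        (hset _ hp1 ▸ (hc.update (hnotin hα))) ⟨p 1, b, ?_, ?_⟩ fun x hx =>
          Function.update_of_ne (ne_of_mem_of_not_mem hp1 hx).symm _ _
      · refine ((hY.of_forall _ _).insert_of_twins (v := p 0) (hadj 0 (by omega)) hb.1 hb1.symm
          (hdeg 0 (by omega))).closure (hinsert 0 (by omega) ?_ ?_) (by simp) ?_
          (hdegX (Finset.erase_subset _ _) _) fun Z hZ hZX hcl' => ?_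
        · simpa [hp0] using hne 0 1 (by omega) (by omega) (by omega)
        · exact Finset.subset_erase.2 ⟨hYX, hdisj 1 (by omega)⟩
        · exact fun h => hb.2 (Finset.mem_of_mem_erase h)
        · have hmem : ∀ j ≤ n, j ≠ 1 → p j ∈ X.erase (p 1) := fun j hj hj1 =>
            Finset.mem_erase.2 ⟨hne j 1 hj (by omega) hj1, hpX j hj⟩
          have h0 : p 0 ∈ Z := hZ (Finset.mem_insert_self _ _)
          have hn : p n ∈ Z := hcl' _ (hmem n le_rfl (by omega)) _ h0 hcl.symm
          have := hdown 2 n le_rfl hn fun j hj hjn hjZ =>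
            hcl' _ (hmem j (by omega) (by omega)) _ hjZ (hadj j hjn)
          intro x hx
          rcases hXcases x (Finset.mem_of_mem_erase hx) with h | ⟨j, hj, rfl⟩
          · exact hZ (Finset.mem_insert_of_mem h)
          · obtain rfl | rfl | hj2 : j = 0 ∨ j = 1 ∨ 2 ≤ j := by omega
            · exact h0
            · simp at hx
            · exact this j hj2 hj
      · rw [Function.update_self, Function.update_of_ne hb1, hcb]
    · have hb0 : b₀ ≠ p 0 := fun h => hb₀.2 (h ▸ hp0)
      refine hagree (Z := X.erase (p 0)) (Finset.erase_subset _ _)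
        (hset _ hp0 ▸ (hc.update (hnotin hcase'))) ⟨p 0, b₀, ?_, ?_⟩ fun x hx =>
          Function.update_of_ne (ne_of_mem_of_not_mem hp0 hx).symm _ _
      · refine ((hY.of_forall _ _).insert_of_twins (v := p n) hcl.symm hb₀.1 hb0.symm
          (hdeg n le_rfl)).closure (hinsert n le_rfl ?_ ?_) (by simp) ?_
          (hdegX (Finset.erase_subset _ _) _) fun Z hZ hZX hcl' => ?_
        · simpa [hpn] using hne n 0 le_rfl (by omega) (by omega)
        · exact Finset.subset_erase.2 ⟨hYX, hdisj 0 (by omega)⟩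
        · exact fun h => hb₀.2 (Finset.mem_of_mem_erase h)
        · have hmem : ∀ j ≤ n, j ≠ 0 → p j ∈ X.erase (p 0) := fun j hj hj1 =>
            Finset.mem_erase.2 ⟨hne j 0 hj (by omega) hj1, hpX j hj⟩
          have hn : p n ∈ Z := hZ (Finset.mem_insert_self _ _)
          have := hdown 1 n le_rfl hn fun j hj hjn hjZ =>
            hcl' _ (hmem j (by omega) (by omega)) _ hjZ (hadj j hjn)
          intro x hx
          rcases hXcases x (Finset.mem_of_mem_erase hx) with h | ⟨j, hj, rfl⟩
          · exact hZ (Finset.mem_insert_of_mem h)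
          · obtain rfl | hj2 : j = 0 ∨ 1 ≤ j := by omega
            · simp at hx
            · exact this j hj2 hj
      · rw [Function.update_self, Function.update_of_ne hb0, hcb₀]
  · have h1n' : p n ≠ p 1 := hne n 1 le_rfl (by omega) (by omega)
    have hset2 : insert (p n) (X.erase (p 1))ᶜ = ((X.erase (p 1)).erase (p n))ᶜ := by
      ext x
      by_cases hx : x = p n <;> simp [hx, h1n', hpn]
    refine hagree (Z := (X.erase (p 1)).erase (p n)) (c₁ := Function.update
      (Function.update c (p 1) α) (p n) α)
      ((Finset.erase_subset _ _).trans (Finset.erase_subset _ _)) ?_ ⟨p 1, p n, ?_, ?_⟩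
      fun x hx => ?_
    · rw [← hset2, ← hset _ hp1]
      refine (hc.update (hnotin hα)).update fun u hu hnu => ?_
      rcases Finset.mem_insert.1 hu with rfl | hu
      · exact absurd hnu h1n
      · rw [Function.update_of_ne]
        · exact hnotin hcase u hu hnu
        · rintro rfl
          exact (Finset.mem_compl.1 hu) hp1
    · refine ((hY.of_forall _ _).insert_of_twins (v := p 0) (hadj 0 (by omega)) hcl h1n'.symm
          (hdeg 0 (by omega))).closure (hinsert 0 (by omega) ?_ ?_) (by simp) (by simp)
          (hdegX ((Finset.erase_subset _ _).trans (Finset.erase_subset _ _)) _)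
          fun Z hZ hZX hcl' => ?_
      · simpa [hp0] using ⟨hne 0 n (by omega) (by omega) (by omega),
          hne 0 1 (by omega) (by omega) (by omega)⟩
      · exact Finset.subset_erase.2 ⟨Finset.subset_erase.2 ⟨hYX, hdisj 1 (by omega)⟩,
          hdisj n le_rfl⟩
      · have hmem : ∀ j < n, j ≠ 1 → p j ∈ (X.erase (p 1)).erase (p n) := fun j hj hj1 =>
          Finset.mem_erase.2 ⟨hne j n hj.le le_rfl hj.ne,
            Finset.mem_erase.2 ⟨hne j 1 hj.le (by omega) hj1, hpX j hj.le⟩⟩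
        have h0 : p 0 ∈ Z := hZ (Finset.mem_insert_self _ _)
        have hi : p i ∈ Z := hcl' _ (hmem i hin (by omega)) _ h0 hch.symm
        have hlow := hdown 2 i hin.le hi fun j hj hjn hjZ =>
          hcl' _ (hmem j (by omega) (by omega)) _ hjZ (hadj j (by omega))
        have hhigh := hup i (n - 1) hi fun j hj hjn hjZ =>
          hcl' _ (hmem (j + 1) (by omega) (by omega)) _ hjZ (hadj j (by omega)).symm
        intro x hx
        rcases hXcases x (Finset.mem_of_mem_erase (Finset.mem_of_mem_erase hx)) with
          h | ⟨j, hj, rfl⟩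
        · exact hZ (Finset.mem_insert_of_mem h)
        · have hj1 : j ≠ 1 := by rintro rfl; simp at hx
          have hjn : j ≠ n := by rintro rfl; simp at hx
          obtain rfl | hj2 | hj2 : j = 0 ∨ (2 ≤ j ∧ j ≤ i) ∨ (i ≤ j ∧ j ≤ n - 1) := by omega
          · exact h0
          · exact hlow j hj2.1 hj2.2
          · exact hhigh j hj2.1 hj2.2
    · rw [Function.update_self, Function.update_of_ne h1n'.symm, Function.update_self]
    · rw [Function.update_of_ne, Function.update_of_ne]
      · exact fun h => hx (h ▸ hp1)
      · exact fun h => hx (h ▸ hpn)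

end ChordedCycle

section LongestPath

variable {V : Type*} [Fintype V] [DecidableEq V] {G : SimpleGraph V} [DecidableRel G.Adj]

/-- A longest path inside `F` closes up to a cycle with a chord. -/
theorem exists_isChordedCycle {F : Finset V} (hF : F.Nonempty)
    (h2 : ∀ x ∈ F, 2 ≤ (G.neighborFinset x ∩ F).card)
    (h3 : ∀ x ∈ F, ∀ y ∈ F, ∀ z ∈ F, x ≠ y → G.Adj x z → G.Adj y z →
      3 ≤ (G.neighborFinset x ∩ F).card ∨ 3 ≤ (G.neighborFinset y ∩ F).card) :
    ∃ p n i, IsChordedCycle G p n i ∧ ∀ j ≤ n, p j ∈ F := by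
  let P : (ℕ → V) → ℕ → Prop := fun p n =>
    Set.InjOn p (Set.Iic n) ∧ (∀ j < n, G.Adj (p j) (p (j + 1))) ∧ ∀ j ≤ n, p j ∈ F
  have hbound : ∀ p n, P p n → n + 1 ≤ F.card := by
    rintro p n ⟨hinj, -, hm⟩
    rw [← Finset.card_range (n + 1)]
    refine Finset.card_le_card_of_injOn p (fun j hj => ?_) fun i hi j hj h => hinj ?_ ?_ h
    · exact hm j (by simpa [Nat.lt_succ_iff] using hj)
    · simpa [Nat.lt_succ_iff] using hi
    · simpa [Nat.lt_succ_iff] using hj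
  obtain ⟨x₀, hx₀⟩ := hF
  have hne : {n | ∃ p, P p n}.Nonempty :=
    ⟨0, fun _ => x₀, fun i hi j hj _ => by
      simp only [Set.mem_Iic, Nat.le_zero] at hi hj
      rw [hi, hj], by simp, fun _ _ => hx₀⟩
  have hbdd : BddAbove {n | ∃ p, P p n} :=
    ⟨F.card, fun n ⟨p, hp⟩ => by have := hbound p n hp; omega⟩
  obtain ⟨n, ⟨p, hp⟩, hmax⟩ : ∃ n, (∃ p, P p n) ∧ ∀ m, (∃ p, P p m) → m ≤ n :=
    ⟨_, Nat.sSup_mem hne hbdd, fun m hm => le_csSup hbdd hm⟩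
  have hend : ∀ q, P q n → ∀ y ∈ F, G.Adj (q 0) y → ∃ j, 1 ≤ j ∧ j ≤ n ∧ q j = y := by
    rintro q ⟨hinj, hadj, hm⟩ y hy hqy
    by_contra! hall
    have hyq : ∀ j ≤ n, q j ≠ y := fun j hj => by
      rcases Nat.eq_zero_or_pos j with rfl | hj0
      · exact hqy.ne
      · exact hall j hj0 hj
    have := hmax (n + 1) ⟨fun t => if t = 0 then y else q (t - 1), ?_, ?_, ?_⟩
    · omega
    · intro s hs t ht hst
      simp only [Set.mem_Iic] at hs ht
      simp only at hst
      split_ifs at hst with h h' h'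
      · omega
      · exact absurd hst.symm (hyq _ (by omega))
      · exact absurd hst (hyq _ (by omega))
      · have := hinj (show s - 1 ∈ Set.Iic n by simp; omega)
          (show t - 1 ∈ Set.Iic n by simp; omega) hst
        omega
    · intro j hj
      rcases Nat.eq_zero_or_pos j with rfl | hj0
      · simpa using hqy.symm
      · obtain ⟨i, rfl⟩ : ∃ i, j = i + 1 := ⟨j - 1, by omega⟩
        simpa using hadj i (by omega)
    · intro j hj
      by_cases h : j = 0
      · simpa [h] using hy
      · simpa [h] using hm (j - 1) (by omega)
  have hcard : ∀ q, P q n → (G.neighborFinset (q 0) ∩ F).card ≤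
      ((Finset.Icc 1 n).filter fun j => G.Adj (q 0) (q j)).card := by
    intro q hq
    refine (Finset.card_le_card fun y hy => ?_).trans (Finset.card_image_le (f := q))
    simp only [Finset.mem_inter, SimpleGraph.mem_neighborFinset] at hy
    obtain ⟨j, h1, hj, rfl⟩ := hend q hq y hy.2 hy.1
    exact Finset.mem_image_of_mem _ (by simp [h1, hj, hy.1])
  have hcyc : ∀ q, P q n → 3 ≤ (G.neighborFinset (q 0) ∩ F).card →
      ∃ p n i, IsChordedCycle G p n i ∧ ∀ j ≤ n, p j ∈ F := by
    intro q hq h3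
    have hlt := Finset.pred_card_le_card_erase (a := 1)
      (s := (Finset.Icc 1 n).filter fun j => G.Adj (q 0) (q j))
    have := hcard q hq
    obtain ⟨i, hi, j, hj, hij⟩ := Finset.one_lt_card.1 (show 1 < (((Finset.Icc 1 n).filter
      fun j => G.Adj (q 0) (q j)).erase 1).card by omega)
    simp only [Finset.mem_erase, Finset.mem_filter, Finset.mem_Icc] at hi hj
    have key : ∀ i j, i ≠ 1 → 1 ≤ i → G.Adj (q 0) (q i) → G.Adj (q 0) (q j) → i < j → j ≤ n →
        ∃ p n i, IsChordedCycle G p n i ∧ ∀ j ≤ n, p j ∈ F :=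
      fun i j h1 h1' hi hj hij hjn => ⟨q, j, i, ⟨hq.1.mono (Set.Iic_subset_Iic.2 hjn),
        fun t ht => hq.2.1 t (by omega), hj, by omega, hij, hi⟩, fun t ht => hq.2.2 t (by omega)⟩
    rcases lt_or_gt_of_ne hij with h | h
    · exact key i j hi.1 hi.2.1.1 hi.2.2 hj.2.2 h hj.2.1.2
    · exact key j i hj.1 hj.2.1.1 hj.2.2 hi.2.2 h hi.2.1.2
  have hlt := Finset.pred_card_le_card_erase (a := 1)
    (s := (Finset.Icc 1 n).filter fun j => G.Adj (p 0) (p j))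
  have hc := hcard p hp
  have hc2 := h2 (p 0) (hp.2.2 0 (by omega))
  obtain ⟨j, hj⟩ := Finset.card_pos.1 (show 0 < (((Finset.Icc 1 n).filter
    fun j => G.Adj (p 0) (p j)).erase 1).card by omega)
  simp only [Finset.mem_erase, Finset.mem_filter, Finset.mem_Icc] at hj
  obtain ⟨hj1, ⟨hj1', hjn⟩, hchord⟩ := hj
  have hq : P (fun i => if i < j then p (j - 1 - i) else p i) n := by
    obtain ⟨hinj, hadj, hm⟩ := hp
    refine ⟨fun s hs t ht hst => ?_, fun i hi => ?_, fun i hi => ?_⟩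
    · simp only [Set.mem_Iic] at hs ht
      simp only at hst
      split_ifs at hst with h h' h' <;>
      · have := hinj (by simp; omega) (by simp; omega) hst
        omega
    · rcases lt_trichotomy (i + 1) j with h | h | h
      · have := (hadj (j - 1 - (i + 1)) (by omega)).symm
        rw [show j - 1 - (i + 1) + 1 = j - 1 - i by omega] at this
        simpa [h, show i < j by omega] using this
      · subst h
        simpa using hchord
      · simpa [show ¬ i < j by omega, show ¬ i + 1 < j by omega] using hadj i hi
    · simp only
      split_ifs
      · exact hm _ (by omega)
      · exact hm _ hi
  have hj0 : 0 < j := by omega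
  have hadj' := hp.2.1 (j - 1) (by omega)
  rw [Nat.sub_add_cancel hj0] at hadj'
  rcases h3 (p 0) (hp.2.2 0 (by omega)) (p (j - 1)) (hp.2.2 _ (by omega)) (p j) (hp.2.2 _ hjn)
    (fun h => by
      have := hp.1 (by simp) (by simp; omega) h
      omega) hchord hadj' with h | h
  · exact hcyc p hp h
  · have hq0 : (if 0 < j then p (j - 1 - 0) else p 0) = p (j - 1) := by simp [hj0]
    exact hcyc _ hq (show 3 ≤ (G.neighborFinset (if 0 < j then p (j - 1 - 0) else p 0) ∩ F).card by
      rwa [hq0])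

end LongestPath

section FarRegion

variable {V : Type*} {G : SimpleGraph V}

/-- `x` and `y` are joined by a non-backtracking walk of length at most four with inner vertices
in `X`. -/
def Near (G : SimpleGraph V) (X : Finset V) (x y : V) : Prop :=
  G.Adj x y ∨ (∃ a ∈ X, G.Adj x a ∧ G.Adj a y) ∨
    (∃ a ∈ X, ∃ b ∈ X, G.Adj x a ∧ G.Adj a b ∧ G.Adj b y ∧ x ≠ b ∧ a ≠ y) ∨
    ∃ a ∈ X, ∃ b ∈ X, ∃ c ∈ X,
      G.Adj x a ∧ G.Adj a b ∧ G.Adj b c ∧ G.Adj c y ∧ x ≠ b ∧ a ≠ c ∧ b ≠ y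

theorem Near.symm {X : Finset V} {x y : V} (h : Near G X x y) : Near G X y x := by
  rcases h with h | ⟨a, ha, h₁, h₂⟩ | ⟨a, ha, b, hb, h₁, h₂, h₃, n₁, n₂⟩ |
    ⟨a, ha, b, hb, c, hc, h₁, h₂, h₃, h₄, n₁, n₂, n₃⟩
  · exact Or.inl h.symm
  · exact Or.inr (Or.inl ⟨a, ha, h₂.symm, h₁.symm⟩)
  · exact Or.inr (Or.inr (Or.inl ⟨b, hb, a, ha, h₃.symm, h₂.symm, h₁.symm, n₂.symm, n₁.symm⟩))
  · exact Or.inr (Or.inr (Or.inr ⟨c, hc, b, hb, a, ha, h₄.symm, h₃.symm, h₂.symm, h₁.symm,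
      n₃.symm, n₂.symm, n₁.symm⟩))

variable [Fintype V] [DecidableEq V] [DecidableRel G.Adj] {k : ℕ} {W X : Finset V}

/-- `X` is a set of `k`-valent vertices at distance at least two from `W` whose outer neighbors
are adjacent to `W`. -/
structure IsFarRegion (G : SimpleGraph V) [DecidableRel G.Adj] (k : ℕ) (W X : Finset V) :
    Prop where
  degree_eq : ∀ x ∈ X, G.degree x = k
  notMem : ∀ x ∈ X, x ∉ W
  not_adj : ∀ x ∈ X, ∀ w ∈ W, ¬ G.Adj x w
  exists_adj_of_outer : ∀ x ∈ X, ∀ y, G.Adj x y → y ∉ X → ∃ w ∈ W, G.Adj y w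
  exists_inner : ∀ x ∈ X, ∃ y ∈ X, G.Adj x y

theorem IsFarRegion.sum_card_outer_le (h : IsFarRegion G k W X) (hg : 9 ≤ G.egirth)
    {A : Finset V} (hA : A ⊆ X) (hnear : ∀ x ∈ A, ∀ y ∈ A, x ≠ y → Near G X x y) :
    ∑ x ∈ A, (G.neighborFinset x \ X).card ≤ W.card := by
  rw [← Finset.card_sigma]
  have hex : ∀ q : (Σ _ : V, V), ∃ w, q ∈ A.sigma (fun x => G.neighborFinset x \ X) →
      w ∈ W ∧ G.Adj q.2 w := by
    rintro ⟨x, y⟩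
    by_cases hq : (⟨x, y⟩ : Σ _ : V, V) ∈ A.sigma (fun x => G.neighborFinset x \ X)
    · have hq' := hq
      simp only [Finset.mem_sigma, Finset.mem_sdiff, SimpleGraph.mem_neighborFinset] at hq'
      obtain ⟨w, hw, hyw⟩ := h.exists_adj_of_outer x (hA hq'.1) y hq'.2.1 hq'.2.2
      exact ⟨w, fun _ => ⟨hw, hyw⟩⟩
    · exact ⟨x, fun hq' => absurd hq' hq⟩
  choose f hf using hex
  refine Finset.card_le_card_of_injOn f (fun q hq => (hf q hq).1) ?_
  rintro ⟨x, y⟩ hq ⟨x', y'⟩ hq' hw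
  have h₁ := hf _ hq
  have h₂ := hf _ hq'
  rw [← hw] at h₂
  simp only [Finset.coe_sigma, Set.mem_sigma_iff, Finset.mem_coe, Finset.mem_sdiff,
    SimpleGraph.mem_neighborFinset] at hq hq'
  set w := f ⟨x, y⟩
  have hxX := hA hq.1
  have hxX' := hA hq'.1
  have hxw : w ≠ x := fun e => h.notMem x hxX (e ▸ h₁.1)
  have hxw' : x' ≠ w := fun e => h.notMem x' hxX' (e ▸ h₁.1)
  have hy : ∀ a ∈ X, y ≠ a := fun a ha e => hq.2.2 (e ▸ ha)
  have hy' : ∀ a ∈ X, a ≠ y' := fun a ha e => hq'.2.2 (e ▸ ha)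
  by_cases hxx : x = x'
  · subst hxx
    rw [eq_of_common_neighbors hg hq.2.1 h₁.2 hq'.2.1 h₂.2 hxw.symm]
  · exfalso
    rcases hnear x hq.1 x' hq'.1 hxx with
      e₁ | ⟨a, ha, e₁, e₂⟩ | ⟨a, ha, b, hb, e₁, e₂, e₃, n₁, n₂⟩ |
      ⟨a, ha, b, hb, c, hc, e₁, e₂, e₃, e₄, n₁, n₂, n₃⟩
    · exact false_of_closed_five hg h₁.2.symm hq.2.1.symm e₁ hq'.2.1 h₂.2 hxw (hy _ hxX')
        (hy' _ hxX) hxw'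
    · exact false_of_closed_six hg h₁.2.symm hq.2.1.symm e₁ e₂ hq'.2.1 h₂.2 hxw (hy _ ha) hxx
        (hy' _ ha) hxw'
    · exact false_of_closed_seven hg h₁.2.symm hq.2.1.symm e₁ e₂ e₃ hq'.2.1 h₂.2 hxw (hy _ ha) n₁
        n₂ (hy' _ hb) hxw'
    · exact false_of_closed_eight hg h₁.2.symm hq.2.1.symm e₁ e₂ e₃ e₄ hq'.2.1 h₂.2 hxw (hy _ ha)
        n₁ n₂ n₃ (hy' _ hc) hxw'

theorem IsFarRegion.exists_isChordedCycle (h : IsFarRegion G k W X) (hg : 9 ≤ G.egirth)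
    (hk : 4 ≤ k) (hW : W.card = k) (hX : X.Nonempty) :
    ∃ p n i, IsChordedCycle G p n i ∧ ∀ j ≤ n, p j ∈ X := by
  set t : V → ℕ := fun x => (G.neighborFinset x \ X).card with ht
  have hcount : ∀ x ∈ X, (G.neighborFinset x ∩ X).card + t x = k := fun x hx => by
    rw [ht, ← h.degree_eq x hx, ← G.card_neighborFinset_eq_degree,
      Finset.card_inter_add_card_sdiff]
  set B := X.filter fun x => k - 2 ≤ t x with hB
  set F := X.filter fun x => ¬ k - 2 ≤ t x with hF
  have hmemB : ∀ {x}, x ∈ B ↔ x ∈ X ∧ k - 2 ≤ t x := fun {x} => by rw [hB, Finset.mem_filter]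
  have hmemF : ∀ {x}, x ∈ F ↔ x ∈ X ∧ ¬ k - 2 ≤ t x := fun {x} => by rw [hF, Finset.mem_filter]
  have hsplit : ∀ x, (G.neighborFinset x ∩ B).card + (G.neighborFinset x ∩ F).card =
      (G.neighborFinset x ∩ X).card := fun x => by
    rw [hB, hF, Finset.inter_filter, Finset.inter_filter,
      Finset.card_filter_add_card_filter_not]
  have hstar : ∀ x ∈ X, ∀ S ⊆ G.neighborFinset x ∩ B,
      t x + S.card * (k - 2) ≤ k := by
    intro x hx S hS
    have hS' : ∀ y ∈ S, G.Adj x y ∧ y ∈ X ∧ k - 2 ≤ t y := fun y hy => by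
      have := hS hy
      rw [Finset.mem_inter, SimpleGraph.mem_neighborFinset, hmemB] at this
      exact this
    have hxS : x ∉ S := fun hxS => G.irrefl (hS' x hxS).1
    have := h.sum_card_outer_le hg (A := insert x S)
      (Finset.insert_subset hx fun y hy => (hS' y hy).2.1) (by
        intro a ha b hb hab
        rcases Finset.mem_insert.1 ha with rfl | ha' <;>
          rcases Finset.mem_insert.1 hb with rfl | hb'
        · exact absurd rfl hab
        · exact Or.inl (hS' b hb').1
        · exact Or.inl (hS' a ha').1.symm
        · exact Or.inr (Or.inl ⟨x, hx, (hS' a ha').1.symm, (hS' b hb').1⟩))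
    rw [Finset.sum_insert hxS, hW] at this
    have h2 := Finset.card_nsmul_le_sum S t (k - 2) fun y hy => (hS' y hy).2.2
    rw [smul_eq_mul] at h2
    change t x + S.sum t ≤ k at this
    omega
  obtain ⟨l, rfl⟩ : ∃ l, k = l + 4 := ⟨k - 4, by omega⟩
  rw [show l + 4 - 2 = l + 2 by omega] at *
  have hFX : ∀ {x}, x ∈ F → x ∈ X := fun hx => (hmemF.1 hx).1
  have hne : F.Nonempty := by
    by_contra hemp
    rw [Finset.not_nonempty_iff_eq_empty] at hemp
    obtain ⟨x, hx⟩ := hX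
    obtain ⟨y, hy, hxy⟩ := h.exists_inner x hx
    have h1 := hsplit x
    have h2 := hstar x hx _ subset_rfl
    have h3 := hcount x hx
    have h4 : 0 < (G.neighborFinset x ∩ X).card := Finset.card_pos.2 ⟨y, by simp [hy, hxy]⟩
    rw [hemp, Finset.inter_empty, Finset.card_empty] at h1
    set s := (G.neighborFinset x ∩ B).card
    nlinarith
  suffices hsuff : ∃ p n i, IsChordedCycle G p n i ∧ ∀ j ≤ n, p j ∈ F by
    obtain ⟨p, n, i, hp, hpF⟩ := hsuff
    exact ⟨p, n, i, hp, fun j hj => hFX (hpF j hj)⟩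
  refine _root_.exists_isChordedCycle hne (fun x hx => ?_) fun x hx y hy z hz hxy hxz hyz => ?_
  · have h1 := hsplit x
    have h2 := hstar x (hFX hx) _ subset_rfl
    have h3 := hcount x (hFX hx)
    have h4 := (hmemF.1 hx).2
    set s := (G.neighborFinset x ∩ B).card
    by_contra! hlt
    have : 2 ≤ s := by omega
    have : s ≤ 2 := by nlinarith
    nlinarith
  · by_contra! hlt
    have hxn := hsplit x
    have hyn := hsplit y
    have hxc := hcount x (hFX hx)
    have hyc := hcount y (hFX hy)
    have hxt := (hmemF.1 hx).2
    have hyt := (hmemF.1 hy).2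
    set S := G.neighborFinset x ∩ B with hS
    set S' := G.neighborFinset y ∩ B with hS'
    have hmS : ∀ {b}, b ∈ S → G.Adj x b ∧ b ∈ X ∧ l + 2 ≤ t b := fun hb => by
      rwa [hS, Finset.mem_inter, SimpleGraph.mem_neighborFinset, hmemB] at hb
    have hmS' : ∀ {b}, b ∈ S' → G.Adj y b ∧ b ∈ X ∧ l + 2 ≤ t b := fun hb => by
      rwa [hS', Finset.mem_inter, SimpleGraph.mem_neighborFinset, hmemB] at hb
    have hzb : ∀ {b}, l + 2 ≤ t b → b ≠ z := fun hb e => (hmemF.1 hz).2 (e ▸ hb)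
    have hdisj : Disjoint S S' := Finset.disjoint_left.2 fun b hb hb' =>
      hzb (hmS hb).2.2 (eq_of_common_neighbors hg (hmS hb).1 (hmS' hb').1.symm hxz hyz.symm hxy)
    have hxS' : x ∉ S ∪ S' := fun hm => by
      rcases Finset.mem_union.1 hm with hm | hm
      · exact hxt (hmS hm).2.2
      · exact hxt (hmS' hm).2.2
    have key := h.sum_card_outer_le hg (A := insert x (S ∪ S')) (by
      refine Finset.insert_subset (hFX hx) (Finset.union_subset ?_ ?_)
      · exact fun b hb => (hmS hb).2.1
      · exact fun b hb => (hmS' hb).2.1) (by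
      have hcross : ∀ {b b'}, b ∈ S → b' ∈ S' → Near G X b b' := fun {b b'} hb hb' =>
        Or.inr (Or.inr (Or.inr ⟨x, hFX hx, z, hFX hz, y, hFX hy, (hmS hb).1.symm, hxz, hyz.symm,
          (hmS' hb').1, hzb (hmS hb).2.2, hxy, (hzb (hmS' hb').2.2).symm⟩))
      have hroot : ∀ {b}, b ∈ S ∪ S' → Near G X x b := fun {b} hb => by
        rcases Finset.mem_union.1 hb with hb | hb
        · exact Or.inl (hmS hb).1
        · exact Or.inr (Or.inr (Or.inl ⟨z, hFX hz, y, hFX hy, hxz, hyz.symm, (hmS' hb).1, hxy,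
            (hzb (hmS' hb).2.2).symm⟩))
      intro a ha b hb hab
      rcases Finset.mem_insert.1 ha with rfl | ha' <;> rcases Finset.mem_insert.1 hb with rfl | hb'
      · exact absurd rfl hab
      · exact hroot hb'
      · exact (hroot ha').symm
      · rcases Finset.mem_union.1 ha' with ha | ha <;> rcases Finset.mem_union.1 hb' with hb | hb
        · exact Or.inr (Or.inl ⟨x, hFX hx, (hmS ha).1.symm, (hmS hb).1⟩)
        · exact hcross ha hb
        · exact (hcross hb ha).symm
        · exact Or.inr (Or.inl ⟨y, hFX hy, (hmS' ha).1.symm, (hmS' hb).1⟩))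
    have h2 := Finset.card_nsmul_le_sum (S ∪ S') t (l + 2) fun b hb => by
      rcases Finset.mem_union.1 hb with hb | hb
      · exact (hmS hb).2.2
      · exact (hmS' hb).2.2
    rw [Finset.sum_insert hxS', hW] at key
    change t x + (S ∪ S').sum t ≤ l + 4 at key
    rw [smul_eq_mul, Finset.card_union_of_disjoint hdisj] at h2
    have h3 : 2 ≤ S.card + S'.card := by omega
    have h4 : S.card + S'.card ≤ 2 := by nlinarith
    have h5 : S.card + S'.card = 2 := by omega
    rw [h5] at h2
    omega

/-- A set `R` of vertices of degree at most `k` whose neighbors lie in `R` or are adjacent to `W`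
is extendable, provided no vertex of `R` has all its neighbors adjacent to `W`. -/
theorem extendable_of_far (hg : 9 ≤ G.egirth) (hW : W.card = k) {R : Finset V} (v : V)
    (hdeg : ∀ x ∈ R, G.degree x ≤ k) (hRW : ∀ x ∈ R, x ∉ W) (hnW : ∀ x ∈ R, ∀ w ∈ W, ¬ G.Adj x w)
    (hout : ∀ x ∈ R, ∀ y, G.Adj x y → y ∉ R → ∃ w ∈ W, G.Adj y w)
    (hin : ∀ x ∈ R, G.degree x = k → ∃ y ∈ R, G.Adj x y)
    (hk : 4 ≤ k ∨ 2 ≤ k ∧ ∀ x, k ≤ G.degree x → ∃ y, G.Adj x y ∧ ∀ z, G.Adj y z → z = x) :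
    Extendable G k v v R := by
  classical
  obtain ⟨Y, hY, hmax⟩ := Finset.exists_max_image
    (R.powerset.filter fun Y => Extendable G k v v Y) Finset.card
    ⟨∅, by simp [extendable_empty]⟩
  simp only [Finset.mem_filter, Finset.mem_powerset] at hY hmax
  obtain ⟨hYR, hYe⟩ := hY
  rcases hYR.eq_or_ssubset with rfl | hss
  · exact hYe
  exfalso
  have hno : ∀ x ∈ R \ Y, ¬ Extendable G k v v (insert x Y) := fun x hx he => by
    rw [Finset.mem_sdiff] at hx
    have := hmax _ ⟨Finset.insert_subset hx.1 hYR, he⟩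
    rw [Finset.card_insert_of_notMem hx.2] at this
    omega
  have hadjY : ∀ x ∈ R \ Y, ∀ y ∈ Y, ¬ G.Adj x y := fun x hx y hy hxy =>
    hno x hx (hYe.insert_of_adj (Or.inl rfl) hy hxy (hdeg x (Finset.mem_sdiff.1 hx).1))
  have hfar : IsFarRegion G k W (R \ Y) := by
    have hR : ∀ x ∈ R \ Y, x ∈ R := fun x hx => (Finset.mem_sdiff.1 hx).1
    refine ⟨fun x hx => ?_, fun x hx => hRW x (hR x hx), fun x hx => hnW x (hR x hx),
      fun x hx y hxy hy => ?_, fun x hx => ?_⟩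
    · refine (hdeg x (hR x hx)).antisymm (not_lt.1 fun hlt => hno x hx ?_)
      exact hYe.insert_of_degree_lt (Or.inl rfl) hlt
    · refine hout x (hR x hx) y hxy fun hyR => hadjY x hx y ?_ hxy
      simpa [hyR] using hy
    · have hdx : G.degree x = k := (hdeg x (hR x hx)).antisymm (not_lt.1 fun hlt => hno x hx
        (hYe.insert_of_degree_lt (Or.inl rfl) hlt))
      obtain ⟨y, hyR, hxy⟩ := hin x (hR x hx) hdx
      exact ⟨y, Finset.mem_sdiff.2 ⟨hyR, fun hy => hadjY x hx y hy hxy⟩, hxy⟩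
  have hne : (R \ Y).Nonempty := Finset.sdiff_nonempty.2 hss.2
  rcases hk with hk | ⟨hk, hleaf⟩
  · obtain ⟨p, n, i, hp, hpX⟩ := hfar.exists_isChordedCycle hg hk hW hne
    have hpX' := fun j hj => Finset.mem_sdiff.1 (hpX j hj)
    have he := hYe.union_chordedCycle hg hp (fun j hj => (hpX' j hj).2)
      fun j hj => hdeg _ (hpX' j hj).1
    have := hmax _ ⟨Finset.union_subset hYR (Finset.image_subset_iff.2 fun j hj =>
      (hpX' j (by simpa [Nat.lt_succ_iff] using hj)).1), he⟩
    refine absurd this (not_le.2 (Finset.card_lt_card ⟨Finset.subset_union_left, fun hsub => ?_⟩))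
    exact (hpX' 0 (by omega)).2 (hsub (Finset.mem_union_right _
      (Finset.mem_image_of_mem _ (by simp))))
  · obtain ⟨x, hx⟩ := hne
    obtain ⟨y, hxy, hy⟩ := hleaf x (hfar.degree_eq x hx).ge
    have hyX : y ∈ R \ Y := by
      by_contra hyX
      obtain ⟨w, hw, hyw⟩ := hfar.exists_adj_of_outer x hx y hxy hyX
      exact hfar.notMem x hx (hy w hyw ▸ hw)
    have hd := hfar.degree_eq y hyX
    have : G.neighborFinset y ⊆ {x} := fun z hz => by simpa using hy z (by simpa using hz)
    have := Finset.card_le_card this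
    rw [G.card_neighborFinset_eq_degree, Finset.card_singleton] at this
    omega

end FarRegion

section Paths

variable {V : Type*} {G : SimpleGraph V}

/-- If every vertex of `A` is the end or the penultimate vertex of a short path from `r` to `W`,
and the ambiguous configurations are excluded with the help of `D`, then `A` is at most as large
as `W`. -/
theorem card_le_card_of_paths (hg : 9 ≤ G.egirth) {r : V} {A W D : Finset V}
    (h : ∀ v ∈ A, ∃ w ∈ W, ∃ p : G.Walk r w, p.IsPath ∧ p.length ≤ 4 ∧
      (v = w ∧ (p.penultimate ∈ D ∨ p.penultimate ∉ A) ∨ v = p.penultimate ∧ v ∉ D)) :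
    A.card ≤ W.card := by
  choose! f hf p hp hl hs using h
  refine Finset.card_le_card_of_injOn f hf fun v hv v' hv' he => ?_
  have hpen : (p v hv).penultimate = (p v' hv').penultimate := by
    have : ((p v hv).copy rfl he) = p v' hv' :=
      path_unique_of_nine_le_egirth hg (by simpa using hp v hv) (hp v' hv')
        (by have := hl v hv; have := hl v' hv'; simp; omega)
    rw [← this]
    simp [SimpleGraph.Walk.penultimate]
  have h₁ := hs v hv
  have h₂ := hs v' hv'
  rw [← hpen, ← he] at h₂
  rcases h₁ with ⟨h₁, h₁'⟩ | ⟨h₁, h₁'⟩ <;> rcases h₂ with ⟨h₂, h₂'⟩ | ⟨h₂, h₂'⟩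
  · rw [h₁, h₂]
  · rw [← h₂] at h₁'
    exact absurd hv' (h₁'.resolve_left h₂')
  · rw [← h₁] at h₂'
    exact absurd hv (h₂'.resolve_left h₁')
  · rw [h₁, h₂]

theorem exists_path_one {a b : V} (h : G.Adj a b) :
    ∃ p : G.Walk a b, p.IsPath ∧ p.length = 1 ∧ p.penultimate = a ∧ p.support = [a, b] :=
  ⟨.cons h .nil, by simp [h.ne], rfl, rfl, rfl⟩

theorem exists_path_two {a b c : V} (h₁ : G.Adj a b) (h₂ : G.Adj b c) (n : a ≠ c) :
    ∃ p : G.Walk a c, p.IsPath ∧ p.length = 2 ∧ p.penultimate = b ∧ p.support = [a, b, c] :=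
  ⟨.cons h₁ (.cons h₂ .nil), by simp [h₁.ne, h₂.ne, n], rfl, rfl, rfl⟩

theorem exists_path_three (hg : 9 ≤ G.egirth) {a b c d : V} (h₁ : G.Adj a b) (h₂ : G.Adj b c)
    (h₃ : G.Adj c d) (n₁ : a ≠ c) (n₂ : b ≠ d) :
    ∃ p : G.Walk a d, p.IsPath ∧ p.length = 3 ∧ p.penultimate = c ∧ p.support = [a, b, c, d] :=
  have hn : a ≠ d := fun e => false_of_closed_three hg h₁ h₂ (e ▸ h₃)
  ⟨.cons h₁ (.cons h₂ (.cons h₃ .nil)), by simp [h₁.ne, h₂.ne, h₃.ne, n₁, n₂, hn], rfl, rfl, rfl⟩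

end Paths

section Shared

variable {V : Type*} {G : SimpleGraph V} {k : ℕ} {W S : Finset V}

/-- Every vertex of `S` lies outside `W` and has two neighbors in `W`. -/
def IsShared (G : SimpleGraph V) (W S : Finset V) : Prop :=
  ∀ u ∈ S, u ∉ W ∧ ∃ w ∈ W, ∃ w' ∈ W, w ≠ w' ∧ G.Adj u w ∧ G.Adj u w'

theorem IsShared.exists_adj_ne (hS : IsShared G W S) {u : V} (hu : u ∈ S) (w : V) :
    ∃ w' ∈ W, w ≠ w' ∧ G.Adj u w' := by
  obtain ⟨-, a, ha, b, hb, hab, hua, hub⟩ := hS u hu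
  by_cases h : w = a
  · exact ⟨b, hb, h ▸ hab, hub⟩
  · exact ⟨a, ha, h, hua⟩

theorem exists_notMem_image_of_card_lt {c : V → Fin k} {A : Finset V} (h : A.card < k) :
    ∃ α, ∀ v ∈ A, c v ≠ α := by
  by_contra! hall
  have h1 := Finset.card_le_card (fun α _ => Finset.mem_image.2 (hall α) :
    (Finset.univ : Finset (Fin k)) ⊆ A.image c)
  rw [Finset.card_univ, Fintype.card_fin] at h1
  have := Finset.card_image_le (s := A) (f := c)
  omega

variable [DecidableEq V] [DecidableRel G.Adj]

/-- The vertices whose colors are not available for `u`, when the vertices in `W ∪ T` have been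
colored. -/
def blockers (G : SimpleGraph V) [DecidableRel G.Adj] (W T : Finset V) (u : V) : Finset V :=
  (W ∪ T).filter fun v => G.Adj u v ∨ ∃ a ∈ W, G.Adj u a ∧ G.Adj a v

theorem IsShared.card_blockers_lt (hS : IsShared G W S) (hg : 9 ≤ G.egirth) {z u : V} (hz : z ∈ S)
    (hu : u ∈ S) (huz : u ≠ z) {T : Finset V} (hT : T ⊆ S) (hzT : z ∉ T) (huT : u ∉ T) :
    (blockers G W T u).card < W.card := by
  have hzW := (hS z hz).1
  have huW := (hS u hu).1
  have hpath : ∀ v ∈ blockers G W T u, ∃ w ∈ W, ∃ p : G.Walk u w, (p.IsPath ∧ p.length ≤ 3 ∧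
      z ∉ p.support) ∧ (v = w ∧ (p.penultimate ∈ W ∨ p.penultimate ∉ blockers G W T u) ∨
        v = p.penultimate ∧ v ∉ W) := by
    intro v hv
    rw [blockers, Finset.mem_filter, Finset.mem_union] at hv
    have huv : u ≠ v := by
      rintro rfl
      exact hv.1.elim huW huT
    have hvz : z ≠ v := by
      rintro rfl
      exact hv.1.elim hzW hzT
    have hWz : ∀ {w}, w ∈ W → z ≠ w := fun hw e => hzW (e ▸ hw)
    have huu : u ∉ blockers G W T u := fun h => by
      rw [blockers, Finset.mem_filter, Finset.mem_union] at h
      exact h.1.elim huW huT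
    by_cases hvW : v ∈ W
    · rcases hv.2 with hadj | ⟨a, ha, hua, hav⟩
      · obtain ⟨p, hp, hl, hpen, hsup⟩ := exists_path_one hadj
        exact ⟨v, hvW, p, ⟨hp, by omega, by simp [hsup, huz.symm, hvz]⟩,
          Or.inl ⟨rfl, Or.inr (by rwa [hpen])⟩⟩
      · obtain ⟨p, hp, hl, hpen, hsup⟩ := exists_path_two hua hav huv
        exact ⟨v, hvW, p, ⟨hp, by omega, by simp [hsup, huz.symm, hvz, hWz ha]⟩,
          Or.inl ⟨rfl, Or.inl (hpen ▸ ha)⟩⟩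
    · have hvS := hT (hv.1.resolve_left hvW)
      rcases hv.2 with hadj | ⟨a, ha, hua, hav⟩
      · obtain ⟨w, hw, huw, hvw⟩ := hS.exists_adj_ne hvS u
        obtain ⟨p, hp, hl, hpen, hsup⟩ := exists_path_two hadj hvw huw
        exact ⟨w, hw, p, ⟨hp, by omega, by simp [hsup, huz.symm, hvz, hWz hw]⟩,
          Or.inr ⟨hpen.symm, hvW⟩⟩
      · obtain ⟨w, hw, haw, hvw⟩ := hS.exists_adj_ne hvS a
        obtain ⟨p, hp, hl, hpen, hsup⟩ := exists_path_three hg hua hav hvw huv haw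
        exact ⟨w, hw, p, ⟨hp, by omega, by simp [hsup, huz.symm, hvz, hWz hw, hWz ha]⟩,
          Or.inr ⟨hpen.symm, hvW⟩⟩
  obtain ⟨-, w₁, hw₁, w₂, hw₂, hne, hz₁, hz₂⟩ := hS z hz
  have hexcl : ∀ (p : G.Walk u w₁) (q : G.Walk u w₂), p.IsPath → q.IsPath → p.length ≤ 3 →
      q.length ≤ 3 → z ∉ p.support → z ∉ q.support → False := by
    intro p q hp hq hpl hql hpz hqz
    have := path_unique_of_nine_le_egirth hg (hp.concat hpz hz₁.symm) (hq.concat hqz hz₂.symm)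
      (by simp; omega)
    have := congrArg SimpleGraph.Walk.penultimate this
    simp at this
    exact hne this
  obtain ⟨w₀, hw₀, havoid⟩ : ∃ w₀ ∈ W, ∀ p : G.Walk u w₀, p.IsPath → p.length ≤ 3 →
      z ∈ p.support := by
    by_contra! hall
    obtain ⟨p, hp, hpl, hpz⟩ := hall w₁ hw₁
    obtain ⟨q, hq, hql, hqz⟩ := hall w₂ hw₂
    exact hexcl p q hp hq hpl hql hpz hqz
  refine lt_of_le_of_lt (card_le_card_of_paths hg (r := u) (W := W.erase w₀) (D := W)
    fun v hv => ?_) (Finset.card_erase_lt_of_mem hw₀)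
  obtain ⟨w, hw, p, ⟨hp, hl, hpz⟩, hsel⟩ := hpath v hv
  refine ⟨w, Finset.mem_erase.2 ⟨?_, hw⟩, p, hp, by omega, hsel⟩
  rintro rfl
  exact hpz (havoid p hp hl)

variable [Fintype V]

theorem IsShared.exists_rainbow_coloring (hS : IsShared G W S) (hg : 9 ≤ G.egirth)
    (hW : W.card = k) {c₀ : V → Fin k} (hc₀ : Set.InjOn c₀ W) {z : V} (hz : z ∈ S) :
    ∀ T ⊆ S, z ∉ T → ∃ c : V → Fin k, ProperOn G c (W ∪ T) ∧ (∀ w ∈ W, c w = c₀ w) ∧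
      ∀ w ∈ W, Set.InjOn c ↑(G.neighborFinset w ∩ (W ∪ T)) := by
  intro T
  induction T using Finset.induction_on with
  | empty =>
    intro _ _
    refine ⟨c₀, fun u hu v hv huv h => ?_, fun _ _ => rfl, fun w hw => hc₀.mono fun x hx => ?_⟩
    · simp only [Finset.union_empty] at hu hv
      exact huv.ne (hc₀ hu hv h)
    · simp at hx
      exact hx.2
  | insert u T huT ih =>
    intro hTS hzT
    rw [Finset.insert_subset_iff] at hTS
    simp only [Finset.mem_insert, not_or] at hzT
    obtain ⟨c, hc, hcW, hinj⟩ := ih hTS.2 hzT.2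
    have huW := (hS u hTS.1).1
    obtain ⟨α, hα⟩ := exists_notMem_image_of_card_lt (c := c)
      (hW ▸ hS.card_blockers_lt hg hz hTS.1 (Ne.symm hzT.1) hTS.2 hzT.2 huT)
    refine ⟨Function.update c u α, ?_, fun w hw => ?_, fun w hw => ?_⟩
    · rw [Finset.union_insert]
      exact hc.update fun v hv huv => hα v (Finset.mem_filter.2 ⟨hv, Or.inl huv⟩)
    · rw [Function.update_of_ne (ne_of_mem_of_not_mem hw huW), hcW w hw]
    · have hmem : ∀ x ∈ G.neighborFinset w ∩ (W ∪ insert u T), x ≠ u →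
          x ∈ G.neighborFinset w ∩ (W ∪ T) := fun x hx hxu => by
        simp only [Finset.mem_inter, Finset.mem_union, Finset.mem_insert] at hx ⊢
        tauto
      have hcol : ∀ x ∈ G.neighborFinset w ∩ (W ∪ T), G.Adj w u → c x ≠ α := fun x hx hwu => by
        rw [Finset.mem_inter, SimpleGraph.mem_neighborFinset] at hx
        exact hα x (Finset.mem_filter.2 ⟨hx.2, Or.inr ⟨w, hw, hwu.symm, hx.1⟩⟩)
      have hadj : ∀ x ∈ G.neighborFinset w ∩ (W ∪ insert u T), G.Adj w x := fun x hx => by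
        simpa using (Finset.mem_inter.1 hx).1
      intro x hx y hy hxy
      rcases eq_or_ne x u with hxu | hxu <;> rcases eq_or_ne y u with hyu | hyu
      · rw [hxu, hyu]
      · rw [hxu, Function.update_self, Function.update_of_ne hyu] at hxy
        exact absurd hxy.symm (hcol y (hmem y hy hyu) (hxu ▸ hadj x hx))
      · rw [hyu, Function.update_self, Function.update_of_ne hxu] at hxy
        exact absurd hxy (hcol x (hmem x hx hxu) (hyu ▸ hadj y hy))
      · rw [Function.update_of_ne hxu, Function.update_of_ne hyu] at hxy
        exact hinj w hw (hmem x hx hxu) (hmem y hy hyu) hxy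

/-- The vertices of `S` can be colored so that around each vertex of `W` at most one color is
repeated. -/
theorem IsShared.exists_coloring (hS : IsShared G W S) (hg : 9 ≤ G.egirth) (hW : W.card = k)
    (hW2 : ∀ u ∉ W, ∃ w ∈ W, ¬ G.Adj u w) {c₀ : V → Fin k} (hc₀ : Set.InjOn c₀ W) :
    ∃ c : V → Fin k, ProperOn G c (W ∪ S) ∧ (∀ w ∈ W, c w = c₀ w) ∧
      ∀ w ∈ W, (G.neighborFinset w ∩ (W ∪ S)).card ≤
        ((G.neighborFinset w ∩ (W ∪ S)).image c).card + 1 := by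
  rcases S.eq_empty_or_nonempty with rfl | ⟨z, hz⟩
  · refine ⟨c₀, fun u hu v hv huv h => ?_, fun _ _ => rfl, fun w hw => ?_⟩
    · simp only [Finset.union_empty] at hu hv
      exact huv.ne (hc₀ hu hv h)
    · rw [Finset.card_image_of_injOn (hc₀.mono fun x hx => ?_)]
      · exact Nat.le_succ _
      · simp at hx
        exact hx.2
  obtain ⟨c, hc, hcW, hinj⟩ := hS.exists_rainbow_coloring hg hW hc₀ hz (S.erase z)
    (Finset.erase_subset _ _) (by simp)
  have hzW := (hS z hz).1
  have hlt : (G.neighborFinset z ∩ (W ∪ S)).card < k := by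
    by_cases hemp : ∃ y ∈ S, G.Adj z y
    · obtain ⟨y, hy, hzy⟩ := hemp
      obtain ⟨-, w₁, hw₁, w₂, hw₂, hne, hy₁, hy₂⟩ := hS y hy
      rw [← hW]
      refine lt_of_le_of_lt (card_le_card_of_paths hg (r := z) (W := W.erase w₂) (D := W)
        fun v hv => ?_) (Finset.card_erase_lt_of_mem hw₂)
      have hzz : z ∉ G.neighborFinset z ∩ (W ∪ S) := by simp
      simp only [Finset.mem_inter, SimpleGraph.mem_neighborFinset, Finset.mem_union] at hv
      by_cases hvW : v ∈ W
      · obtain ⟨p, hp, hl, hpen, -⟩ := exists_path_one hv.1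
        refine ⟨v, Finset.mem_erase.2 ⟨?_, hvW⟩, p, hp, by omega,
          Or.inl ⟨rfl, Or.inr (by rwa [hpen])⟩⟩
        rintro rfl
        exact false_of_closed_three hg hzy hy₂ hv.1.symm
      · have hvS := hv.2.resolve_left hvW
        obtain ⟨w, hw, hww, hvw⟩ := hS.exists_adj_ne hvS w₂
        have hzw : z ≠ w := (ne_of_mem_of_not_mem hw hzW).symm
        obtain ⟨p, hp, hl, hpen, -⟩ := exists_path_two hv.1 hvw hzw
        exact ⟨w, Finset.mem_erase.2 ⟨hww.symm, hw⟩, p, hp, by omega,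
          Or.inr ⟨hpen.symm, hvW⟩⟩
    · push Not at hemp
      obtain ⟨w, hw, hzw⟩ := hW2 z hzW
      rw [← hW]
      refine Finset.card_lt_card ⟨fun v hv => ?_, fun hsub => hzw ?_⟩
      · simp only [Finset.mem_inter, SimpleGraph.mem_neighborFinset, Finset.mem_union] at hv
        exact hv.2.resolve_right fun h => hemp v h hv.1
      · simpa using (Finset.mem_inter.1 (hsub hw)).1
  obtain ⟨α, hα⟩ := exists_notMem_image_of_card_lt (c := c) hlt
  have hins : W ∪ S = insert z (W ∪ S.erase z) := by
    rw [← Finset.union_insert, Finset.insert_erase hz]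
  refine ⟨Function.update c z α, ?_, fun w hw => ?_, fun w hw => ?_⟩
  · rw [hins]
    refine hc.update fun v hv huv => hα v ?_
    rw [Finset.mem_inter, SimpleGraph.mem_neighborFinset, hins]
    exact ⟨huv, Finset.mem_insert_of_mem hv⟩
  · rw [Function.update_of_ne (ne_of_mem_of_not_mem hw hzW), hcW w hw]
  · have hsub : G.neighborFinset w ∩ (W ∪ S) ⊆
        insert z (G.neighborFinset w ∩ (W ∪ S.erase z)) := fun x hx => by
      rw [Finset.mem_inter, hins, Finset.mem_insert] at hx
      rw [Finset.mem_insert, Finset.mem_inter]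
      tauto
    have h1 := (Finset.card_le_card hsub).trans (Finset.card_insert_le _ _)
    rw [← Finset.card_image_of_injOn (hinj w hw)] at h1
    refine h1.trans (Nat.succ_le_succ (Finset.card_le_card fun β hβ => ?_))
    obtain ⟨x, hx, rfl⟩ := Finset.mem_image.1 hβ
    have hxz : x ≠ z := by
      rintro rfl
      simp [hzW] at hx
    refine Finset.mem_image.2 ⟨x, ?_, Function.update_of_ne hxz _ _⟩
    rw [Finset.mem_inter] at hx ⊢
    exact ⟨hx.1, hins ▸ Finset.mem_insert_of_mem hx.2⟩

end Shared

section Covering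

variable {V : Type*} {k : ℕ}

/-- If the lists of forbidden colors `F` are short on average, the elements of `P` can be colored
so that all colors of `L` appear. -/
theorem exists_covering_coloring {P : Finset V} {L : Finset (Fin k)} {F : V → Finset (Fin k)}
    {a : Fin k} (ha : a ∉ L) (hLP : L.card ≤ P.card) (hsum : ∑ y ∈ P, (F y).card < P.card)
    (hF : ∀ y ∈ P, (F y).card + 2 ≤ k) :
    ∃ h : V → Fin k, (∀ y ∈ P, h y ∉ F y ∧ h y ≠ a) ∧ ∀ l ∈ L, ∃ y ∈ P, h y = l := by
  classical
  have hfree : ∀ y, ∃ β, y ∈ P → β ∉ F y ∧ β ≠ a := by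
    intro y
    by_cases hy : y ∈ P
    · by_contra! hall
      have h1 : (Finset.univ : Finset (Fin k)) ⊆ insert a (F y) := fun β _ => by
        rw [Finset.mem_insert]
        by_contra! hβ
        exact hβ.1 ((hall β).2 hβ.2)
      have h2 := (Finset.card_le_card h1).trans (Finset.card_insert_le _ _)
      rw [Finset.card_univ, Fintype.card_fin] at h2
      have := hF y hy
      omega
    · exact ⟨a, fun h => absurd h hy⟩
  choose g hg using hfree
  obtain ⟨f, hf, hfm⟩ := (Finset.all_card_le_biUnion_card_iff_exists_injective
    (fun l : L => P.filter fun y => (l : Fin k) ∉ F y)).1 (by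
      intro s
      set U := s.biUnion fun l : L => P.filter fun y => (l : Fin k) ∉ F y with hU
      have hsub : ∀ y ∈ P \ U, s.card ≤ (F y).card := by
        intro y hy
        rw [Finset.mem_sdiff, hU, Finset.mem_biUnion] at hy
        rw [← Finset.card_map (Function.Embedding.subtype _)]
        refine Finset.card_le_card fun l hl => ?_
        obtain ⟨l, hls, rfl⟩ := Finset.mem_map.1 hl
        by_contra hlF
        exact hy.2 ⟨l, hls, Finset.mem_filter.2 ⟨hy.1, hlF⟩⟩
      have h1 := Finset.card_nsmul_le_sum (P \ U) (fun y => (F y).card) s.card hsub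
      have h2 : ∑ y ∈ P \ U, (F y).card ≤ ∑ y ∈ P, (F y).card :=
        Finset.sum_le_sum_of_subset Finset.sdiff_subset
      have h3 : U ⊆ P := Finset.biUnion_subset.2 fun l _ => Finset.filter_subset _ _
      have h4 := Finset.card_sdiff_add_card_eq_card h3
      have h5 : s.card ≤ L.card := by
        simpa using Finset.card_le_univ s
      rw [smul_eq_mul] at h1
      rcases Nat.eq_zero_or_pos (P \ U).card with h0 | h0
      · omega
      · rcases Nat.eq_zero_or_pos s.card with hs | hs
        · omega
        · nlinarith)
  simp only [Finset.mem_filter] at hfm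
  refine ⟨fun y => if h : ∃ l, f l = y then (h.choose : Fin k) else g y, fun y hy => ?_,
    fun l hl => ?_⟩
  · simp only
    split_ifs with h
    · have := hfm h.choose
      rw [h.choose_spec] at this
      exact ⟨this.2, ne_of_mem_of_not_mem h.choose.2 ha⟩
    · exact hg y hy
  · refine ⟨f ⟨l, hl⟩, (hfm _).1, ?_⟩
    have h : ∃ l', f l' = f ⟨l, hl⟩ := ⟨_, rfl⟩
    simp only [dif_pos h]
    rw [hf h.choose_spec]

variable [Fintype V] [DecidableEq V] {G : SimpleGraph V} [DecidableRel G.Adj] {W Q D : Finset V}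

/-- A coloring of `W ∪ Q` extends to the neighbors of `W` in such a way that all vertices of `W`
become b-vertices. -/
theorem exists_dominating_coloring (hg : 9 ≤ G.egirth)
    (hD : ∀ v, v ∈ D ↔ v ∉ W ∧ (v ∈ Q ∨ ∃ w ∈ W, G.Adj v w)) {c₀ : V → Fin k}
    (hc₀ : ProperOn G c₀ (W ∪ Q))
    (huniq : ∀ v, v ∉ W ∪ Q → ∀ w ∈ W, ∀ w' ∈ W, G.Adj v w → G.Adj v w' → w = w')
    (hL : ∀ w ∈ W, k ≤ 1 + ((G.neighborFinset w ∩ (W ∪ Q)).image c₀).card +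
      (G.neighborFinset w \ (W ∪ Q)).card)
    (hsum : ∀ w ∈ W, ∑ y ∈ G.neighborFinset w \ (W ∪ Q), (G.neighborFinset y ∩ D).card <
      (G.neighborFinset w \ (W ∪ Q)).card)
    (hfree : ∀ w ∈ W, ∀ y ∈ G.neighborFinset w \ (W ∪ Q), (G.neighborFinset y ∩ D).card + 2 ≤ k) :
    ∃ c : V → Fin k, ProperOn G c (W ∪ D) ∧ (∀ v ∈ W ∪ Q, c v = c₀ v) ∧
      ∀ w ∈ W, ∀ j, j ≠ c w → ∃ x, G.Adj w x ∧ c x = j := by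
  set P : V → Finset V := fun w => G.neighborFinset w \ (W ∪ Q) with hP
  have hmemP : ∀ {w v}, v ∈ P w ↔ G.Adj w v ∧ v ∉ W ∪ Q := fun {w v} => by
    rw [hP, Finset.mem_sdiff, SimpleGraph.mem_neighborFinset]
  have hPD : ∀ {w v}, w ∈ W → v ∈ P w → v ∈ D := fun {w v} hw hv => by
    rw [hmemP, Finset.mem_union, not_or] at hv
    exact (hD v).2 ⟨hv.2.1, Or.inr ⟨w, hw, hv.1.symm⟩⟩
  have main : ∀ T ⊆ W, ∃ c : V → Fin k, ProperOn G c (W ∪ Q ∪ T.biUnion P) ∧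
      (∀ v ∈ W ∪ Q, c v = c₀ v) ∧ ∀ w ∈ T, ∀ j, j ≠ c₀ w →
        ∃ x ∈ W ∪ Q ∪ T.biUnion P, G.Adj w x ∧ c x = j := by
    intro T
    induction T using Finset.induction_on with
    | empty => exact fun _ => ⟨c₀, by simpa using hc₀, fun _ _ => rfl, by simp⟩
    | insert w T hwT ih =>
      intro hTW
      rw [Finset.insert_subset_iff] at hTW
      obtain ⟨hw, hTW⟩ := hTW
      obtain ⟨c, hc, hcag, hcb⟩ := ih hTW
      have hwQ : w ∈ W ∪ Q := Finset.mem_union_left _ hw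
      set I := (G.neighborFinset w ∩ (W ∪ Q)).image c₀ with hI
      have hwI : c₀ w ∉ I := fun hm => by
        obtain ⟨x, hx, hxw⟩ := Finset.mem_image.1 hm
        rw [Finset.mem_inter, SimpleGraph.mem_neighborFinset] at hx
        exact hc₀ w hwQ x hx.2 hx.1 hxw.symm
      have hFle : ∀ y, ((G.neighborFinset y ∩ D).image c).card ≤ (G.neighborFinset y ∩ D).card :=
        fun y => Finset.card_image_le
      obtain ⟨h, hh, hcover⟩ := exists_covering_coloring (P := P w) (L := (insert (c₀ w) I)ᶜ)
        (F := fun y => (G.neighborFinset y ∩ D).image c) (a := c₀ w) (by simp) (by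
          rw [Finset.card_compl, Fintype.card_fin, Finset.card_insert_of_notMem hwI]
          have : k ≤ 1 + I.card + (P w).card := hL w hw
          omega)
        (lt_of_le_of_lt (Finset.sum_le_sum fun y _ => hFle y) (hsum w hw))
        fun y hy => by
          have := hfree w hw y hy
          have := hFle y
          omega
      have hold : ∀ v ∈ W ∪ Q ∪ T.biUnion P, v ∉ P w := by
        intro v hv hvP
        have hvP' := hmemP.1 hvP
        obtain ⟨w', hw', hvw'⟩ := Finset.mem_biUnion.1 ((Finset.mem_union.1 hv).resolve_left hvP'.2)
        have := huniq v hvP'.2 w hw w' (hTW hw') hvP'.1.symm (hmemP.1 hvw').1.symm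
        exact hwT (this ▸ hw')
      have hset : W ∪ Q ∪ (insert w T).biUnion P = P w ∪ (W ∪ Q ∪ T.biUnion P) := by
        rw [Finset.biUnion_insert, Finset.union_left_comm]
      have hnew : ∀ u ∈ P w, ∀ v ∈ W ∪ Q ∪ T.biUnion P, G.Adj u v → h u ≠ c v := by
        intro u hu v hv huv
        by_cases hvW : v ∈ W
        · rw [hcag v (Finset.mem_union_left _ hvW),
            ← huniq u (hmemP.1 hu).2 w hw v hvW (hmemP.1 hu).1.symm huv]
          exact (hh u hu).2
        · have hvD : v ∈ D := by
            rcases Finset.mem_union.1 hv with hv | hv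
            · exact (hD v).2 ⟨hvW, Or.inl ((Finset.mem_union.1 hv).resolve_left hvW)⟩
            · obtain ⟨w', hw', hvw'⟩ := Finset.mem_biUnion.1 hv
              exact hPD (hTW hw') hvw'
          intro he
          exact (hh u hu).1 (Finset.mem_image.2 ⟨v, by simp [huv, hvD], he.symm⟩)
      have hcold : ∀ v ∈ W ∪ Q ∪ T.biUnion P, (if v ∈ P w then h v else c v) = c v :=
        fun v hv => if_neg (hold v hv)
      have hcnew : ∀ v ∈ P w, (if v ∈ P w then h v else c v) = h v := fun v hv => if_pos hv
      refine ⟨fun v => if v ∈ P w then h v else c v, ?_, fun v hv => ?_, fun w' hw' j hj => ?_⟩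
      · rw [hset]
        intro u hu v hv huv
        simp only
        rcases Finset.mem_union.1 hu with hu | hu <;> rcases Finset.mem_union.1 hv with hv | hv
        · exact (false_of_closed_three hg (hmemP.1 hu).1 huv (hmemP.1 hv).1.symm).elim
        · rw [hcnew u hu, hcold v hv]
          exact hnew u hu v hv huv
        · rw [hcold u hu, hcnew v hv]
          exact (hnew v hv u hu huv.symm).symm
        · rw [hcold u hu, hcold v hv]
          exact hc u hu v hv huv
      · simp only
        rw [hcold v (Finset.mem_union_left _ hv), hcag v hv]
      · rw [hset]
        rcases Finset.mem_insert.1 hw' with rfl | hw'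
        · by_cases hjI : j ∈ I
          · obtain ⟨x, hx, rfl⟩ := Finset.mem_image.1 hjI
            rw [Finset.mem_inter, SimpleGraph.mem_neighborFinset] at hx
            have hx' : x ∈ W ∪ Q ∪ T.biUnion P := Finset.mem_union_left _ hx.2
            exact ⟨x, Finset.mem_union_right _ hx', hx.1, (hcold x hx').trans (hcag x hx.2)⟩
          · obtain ⟨y, hy, rfl⟩ := hcover j (by simp [hj, hjI])
            exact ⟨y, Finset.mem_union_left _ hy, (hmemP.1 hy).1, hcnew y hy⟩
        · obtain ⟨x, hx, hwx, rfl⟩ := hcb w' hw' j hj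
          exact ⟨x, Finset.mem_union_right _ hx, hwx, hcold x hx⟩
  obtain ⟨c, hc, hcag, hcb⟩ := main W subset_rfl
  refine ⟨c, hc.mono fun v hv => ?_, hcag, fun w hw j hj => ?_⟩
  · rcases Finset.mem_union.1 hv with hv | hv
    · simp [hv]
    · obtain ⟨hvW, hvQ | ⟨w, hw, hvw⟩⟩ := (hD v).1 hv
      · simp [hvQ]
      · by_cases hvWQ : v ∈ W ∪ Q
        · exact Finset.mem_union_left _ hvWQ
        · exact Finset.mem_union_right _ (Finset.mem_biUnion.2 ⟨w, hw, hmemP.2 ⟨hvw.symm, hvWQ⟩⟩)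
  · obtain ⟨x, -, hx⟩ := hcb w hw j (hcag w (Finset.mem_union_left _ hw) ▸ hj)
    exact ⟨x, hx⟩

end Covering

section Core

variable {V : Type*} [DecidableEq V] {k : ℕ} {W : Finset V}

theorem exists_bijective_coloring (hW : W.card = k) (hk : 0 < k) :
    ∃ c : V → Fin k, Set.InjOn c W ∧ ∀ i, ∃ w ∈ W, c w = i := by
  let e := Finset.equivFinOfCardEq hW
  refine ⟨fun v => if h : v ∈ W then e ⟨v, h⟩ else ⟨0, hk⟩, fun v hv u hu huv => ?_, fun i => ?_⟩
  · simp only [Finset.mem_coe] at hv hu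
    simp only [hv, hu, dite_true] at huv
    simpa using e.injective huv
  · exact ⟨e.symm i, (e.symm i).2, by simp⟩

variable [Fintype V] {G : SimpleGraph V} [DecidableRel G.Adj]

/-- A set `W` of `k` vertices from which a b-coloring with `k` colors can be constructed. -/
structure IsBasis (G : SimpleGraph V) [DecidableRel G.Adj] (k : ℕ) (W : Finset V) : Prop where
  card_eq : W.card = k
  three_le : 3 ≤ k
  le_degree : ∀ w ∈ W, k ≤ G.degree w
  exists_not_adj : ∀ u ∉ W, ∃ w ∈ W, ¬ G.Adj u w
  exists_adj_adj : ∀ v ∉ W, k < G.degree v → ∃ w ∈ W, ∃ w' ∈ W, G.Adj v w ∧ G.Adj w w'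
  four_le_or : 4 ≤ k ∨ 2 ≤ k ∧ ∀ x, k ≤ G.degree x → ∃ y, G.Adj x y ∧ ∀ z, G.Adj y z → z = x

/-- A vertex of degree `k` outside `W`, all of whose neighbors are in or adjacent to `W`. -/
structure IsCenter (G : SimpleGraph V) [DecidableRel G.Adj] (k : ℕ) (W : Finset V) (q : V) :
    Prop where
  notMem : q ∉ W
  degree_eq : G.degree q = k
  mem_or : ∀ y, G.Adj q y → y ∈ W ∨ ∃ w ∈ W, G.Adj y w
  unique : ∀ w ∈ W, ∀ w' ∈ W, G.Adj q w → G.Adj q w' → w = w'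

theorem IsBasis.exists_isBColoring_of_dominating (h : IsBasis G k W) (hg : 9 ≤ G.egirth)
    {Q D : Finset V} (hD : ∀ v, v ∈ D ↔ v ∉ W ∧ (v ∈ Q ∨ ∃ w ∈ W, G.Adj v w))
    (hQ : ∀ q ∈ Q, (∃ w ∈ W, G.Adj q w) ∨ IsCenter G k W q)
    (hcenter : ∀ x, x ∉ W ∪ D → ¬ IsCenter G k W x) {c : V → Fin k} (hc : ProperOn G c (W ∪ D))
    (hsurj : ∀ i, ∃ w ∈ W, c w = i)
    (hdom : ∀ w ∈ W, ∀ j, j ≠ c w → ∃ x, G.Adj w x ∧ c x = j) :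
    ∃ C : V → Fin k, IsBColoring G k C := by
  obtain ⟨v, hv, -⟩ := hsurj ⟨0, by have := h.three_le; omega⟩
  have hWR : ∀ x ∈ (W ∪ D)ᶜ, x ∉ W := fun x hx hxW => by simp [hxW] at hx
  have hnadj : ∀ x ∈ (W ∪ D)ᶜ, ∀ w ∈ W, ¬ G.Adj x w := fun x hx w hw hxw => by
    rw [Finset.mem_compl, Finset.mem_union, not_or, hD] at hx
    exact hx.2 ⟨hx.1, Or.inr ⟨w, hw, hxw⟩⟩
  have hout : ∀ x ∈ (W ∪ D)ᶜ, ∀ y, G.Adj x y → y ∉ (W ∪ D)ᶜ → ∃ w ∈ W, G.Adj y w := by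
    intro x hx y hxy hy
    rw [Finset.mem_compl, not_not, Finset.mem_union, hD] at hy
    rcases hy with hy | ⟨-, hy | hy⟩
    · exact absurd hxy (hnadj x hx y hy)
    · rcases hQ y hy with hy | hy
      · exact hy
      · rcases hy.mem_or x hxy.symm with hxW | ⟨w, hw, hxw⟩
        · exact absurd hxW (hWR x hx)
        · exact absurd hxw (hnadj x hx w hw)
    · exact hy
  have hext := extendable_of_far hg h.card_eq (R := (W ∪ D)ᶜ) v
    (fun x hx => not_lt.1 fun hlt => by
      obtain ⟨w, hw, -, -, hxw, -⟩ := h.exists_adj_adj x (hWR x hx) hlt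
      exact hnadj x hx w hw hxw) hWR hnadj hout
    (fun x hx hdx => by
      by_contra! hall
      refine hcenter x (Finset.mem_compl.1 hx) ⟨hWR x hx, hdx, fun y hxy => Or.inr
        (hout x hx y hxy fun hy => hall y hy hxy), fun w hw _ _ hxw => ?_⟩
      exact absurd hxw (hnadj x hx w hw)) h.four_le_or
  obtain ⟨C, hC, hCc⟩ := hext c (by rwa [compl_compl]) rfl
  have hW : ∀ w ∈ W, C w = c w := fun w hw => hCc w (by simp [hw])
  refine ⟨C, fun u v huv => hC u (Finset.mem_univ _) v (Finset.mem_univ _) huv, fun i => ?_⟩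
  obtain ⟨w, hw, rfl⟩ := hsurj i
  refine ⟨w, hW w hw, fun j hj => ?_⟩
  obtain ⟨x, hwx, rfl⟩ := hdom w hw j (hW w hw ▸ hj)
  refine ⟨x, hwx, hCc x fun hx => ?_⟩
  exact hnadj x hx w hw hwx.symm

theorem IsBasis.exists_isBColoring_of_forall_not_isCenter (h : IsBasis G k W) (hg : 9 ≤ G.egirth)
    (hcenter : ∀ x, ¬ IsCenter G k W x) : ∃ C : V → Fin k, IsBColoring G k C := by
  have hk := h.three_le
  obtain ⟨c₀, hinj, hsurj⟩ := exists_bijective_coloring h.card_eq (by omega)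
  let S : Finset V := Finset.univ.filter fun u =>
    u ∉ W ∧ ∃ w ∈ W, ∃ w' ∈ W, w ≠ w' ∧ G.Adj u w ∧ G.Adj u w'
  have hS : IsShared G W S := fun u hu => (Finset.mem_filter.1 hu).2
  let D : Finset V := Finset.univ.filter fun v => v ∉ W ∧ (v ∈ S ∨ ∃ w ∈ W, G.Adj v w)
  have hD : ∀ v, v ∈ D ↔ v ∉ W ∧ (v ∈ S ∨ ∃ w ∈ W, G.Adj v w) := fun v => by simp [D]
  have hDW : ∀ {v}, v ∈ D → v ∉ W ∧ ∃ w ∈ W, G.Adj v w := fun {v} hv => by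
    obtain ⟨hvW, hv | hv⟩ := (hD v).1 hv
    · obtain ⟨-, w, hw, -, -, -, hvw, -⟩ := hS v hv
      exact ⟨hvW, w, hw, hvw⟩
    · exact ⟨hvW, hv⟩
  have huniq : ∀ v, v ∉ W ∪ S → ∀ w ∈ W, ∀ w' ∈ W, G.Adj v w → G.Adj v w' → w = w' := by
    intro v hv w hw w' hw' hvw hvw'
    by_contra hne
    rw [Finset.mem_union, not_or] at hv
    exact hv.2 (Finset.mem_filter.2 ⟨Finset.mem_univ _, hv.1, w, hw, w', hw', hne, hvw, hvw'⟩)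
  obtain ⟨c, hc, hcW, hcI⟩ := hS.exists_coloring hg h.card_eq h.exists_not_adj hinj
  have hdeg : ∀ w, (G.neighborFinset w ∩ (W ∪ S)).card + (G.neighborFinset w \ (W ∪ S)).card =
      G.degree w := fun w => by
    rw [← G.card_neighborFinset_eq_degree, Finset.card_inter_add_card_sdiff]
  have hcount : ∀ w ∈ W, 1 + (G.neighborFinset w ∩ (W ∪ S)).card +
      ∑ y ∈ G.neighborFinset w \ (W ∪ S), (G.neighborFinset y ∩ D).card ≤ k := by
    intro w hw
    have hmemP : ∀ {y}, y ∈ G.neighborFinset w \ (W ∪ S) → G.Adj w y ∧ y ∉ W ∧ y ∉ S :=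
      fun {y} hy => by simpa using hy
    have hdisj : (↑(G.neighborFinset w \ (W ∪ S)) : Set V).PairwiseDisjoint
        fun y => G.neighborFinset y ∩ D := fun y hy y' hy' hne =>
      Finset.disjoint_left.2 fun z hz hz' => by
        rw [Finset.mem_inter, SimpleGraph.mem_neighborFinset] at hz hz'
        have := eq_of_common_neighbors hg hz.1 hz'.1.symm (hmemP hy).1.symm (hmemP hy').1 hne
        exact (hDW hz.2).1 (this ▸ hw)
    rw [← Finset.card_biUnion hdisj]
    set Z := (G.neighborFinset w \ (W ∪ S)).biUnion fun y => G.neighborFinset y ∩ D with hZ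
    have hmemZ : ∀ {z}, z ∈ Z → z ∈ D ∧ ∃ y, G.Adj w y ∧ y ∉ W ∧ G.Adj y z := fun {z} hz => by
      obtain ⟨y, hy, hz⟩ := Finset.mem_biUnion.1 hz
      rw [Finset.mem_inter, SimpleGraph.mem_neighborFinset] at hz
      exact ⟨hz.2, y, (hmemP hy).1, (hmemP hy).2.1, hz.1⟩
    have hNZ : Disjoint (G.neighborFinset w ∩ (W ∪ S)) Z :=
      Finset.disjoint_left.2 fun z hz hz' => by
        obtain ⟨-, y, hwy, -, hyz⟩ := hmemZ hz'
        exact false_of_closed_three hg hwy hyz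
          (by simpa using (Finset.mem_inter.1 hz).1 : G.Adj w z).symm
    have hwNZ : w ∉ G.neighborFinset w ∩ (W ∪ S) ∪ Z := fun hm => by
      rcases Finset.mem_union.1 hm with hm | hm
      · simp at hm
      · exact (hDW (hmemZ hm).1).1 hw
    rw [add_assoc, ← Finset.card_union_of_disjoint hNZ, add_comm,
      ← Finset.card_insert_of_notMem hwNZ]
    have hwA : w ∈ insert w (G.neighborFinset w ∩ (W ∪ S) ∪ Z) := Finset.mem_insert_self _ _
    rw [← h.card_eq]
    refine card_le_card_of_paths hg (r := w) (D := W) fun v hv => ?_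
    rcases Finset.mem_insert.1 hv with rfl | hv
    · exact ⟨v, hw, .nil, by simp, by simp, Or.inl ⟨rfl, Or.inl (by simpa using hw)⟩⟩
    rcases Finset.mem_union.1 hv with hv | hv
    · rw [Finset.mem_inter, SimpleGraph.mem_neighborFinset] at hv
      by_cases hvW : v ∈ W
      · obtain ⟨p, hp, hl, hpen, -⟩ := exists_path_one hv.1
        exact ⟨v, hvW, p, hp, by omega, Or.inl ⟨rfl, Or.inl (by rwa [hpen])⟩⟩
      · obtain ⟨w', hw', hne, hvw'⟩ :=
          hS.exists_adj_ne ((Finset.mem_union.1 hv.2).resolve_left hvW) w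
        obtain ⟨p, hp, hl, hpen, -⟩ := exists_path_two hv.1 hvw' hne
        exact ⟨w', hw', p, hp, by omega, Or.inr ⟨hpen.symm, hvW⟩⟩
    · obtain ⟨hvD, y, hwy, hyW, hyv⟩ := hmemZ hv
      obtain ⟨hvW, w', hw', hvw'⟩ := hDW hvD
      obtain ⟨p, hp, hl, hpen, -⟩ := exists_path_three hg hwy hyv hvw'
        (ne_of_mem_of_not_mem hw hvW) (ne_of_mem_of_not_mem hw' hyW).symm
      exact ⟨w', hw', p, hp, by omega, Or.inr ⟨hpen.symm, hvW⟩⟩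
  obtain ⟨c', hc', hag, hdom⟩ := exists_dominating_coloring hg hD hc huniq
    (fun w hw => by
      have h1 := hcI w hw
      have h2 := hdeg w
      have h3 := h.le_degree w hw
      omega)
    (fun w hw => by
      have h1 := hcount w hw
      have h2 := hdeg w
      have h3 := h.le_degree w hw
      omega)
    (fun w hw y hy => by
      by_contra hlt
      have h1 := hcount w hw
      have h2 := Finset.single_le_sum (f := fun y => (G.neighborFinset y ∩ D).card)
        (fun _ _ => Nat.zero_le _) hy
      have hy' : G.Adj w y ∧ y ∉ W ∪ S := by
        rwa [Finset.mem_sdiff, SimpleGraph.mem_neighborFinset] at hy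
      have hyW : y ∉ W := fun hm => hy'.2 (Finset.mem_union_left _ hm)
      have hN : G.neighborFinset w ∩ (W ∪ S) = ∅ := Finset.card_eq_zero.1 (by omega)
      have hwD : w ∉ G.neighborFinset y ∩ D := fun hm => (hDW (Finset.mem_inter.1 hm).2).1 hw
      have hsub : insert w (G.neighborFinset y ∩ D) ⊆ G.neighborFinset y :=
        Finset.insert_subset (by simpa using hy'.1.symm) Finset.inter_subset_left
      have hcard := Finset.card_le_card hsub
      rw [Finset.card_insert_of_notMem hwD, G.card_neighborFinset_eq_degree] at hcard
      have hle : G.degree y ≤ k := not_lt.1 fun hlt' => by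
        obtain ⟨w₁, hw₁, w₂, hw₂, hyw₁, hww⟩ := h.exists_adj_adj y hyW hlt'
        obtain rfl := huniq y hy'.2 w hw w₁ hw₁ hy'.1.symm hyw₁
        have : w₂ ∈ G.neighborFinset w ∩ (W ∪ S) := by simp [hww, hw₂]
        simp [hN] at this
      have heq := Finset.eq_of_subset_of_card_le hsub (by
        rw [Finset.card_insert_of_notMem hwD, G.card_neighborFinset_eq_degree]
        omega)
      refine hcenter y ⟨hyW, by omega, fun x hyx => ?_, huniq y hy'.2⟩
      have hx : x ∈ insert w (G.neighborFinset y ∩ D) := by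
        rw [heq]
        simpa using hyx
      rcases Finset.mem_insert.1 hx with rfl | hx
      · exact Or.inl hw
      · exact Or.inr (hDW (Finset.mem_inter.1 hx).2).2)
  refine h.exists_isBColoring_of_dominating hg hD (fun q hq => Or.inl ?_) (fun x _ => hcenter x) hc'
    (fun i => ?_) hdom
  · obtain ⟨-, w, hw, -, -, -, hqw, -⟩ := hS q hq
    exact ⟨w, hw, hqw⟩
  · obtain ⟨w, hw, rfl⟩ := hsurj i
    exact ⟨w, hw, by rw [hag w (Finset.mem_union_left _ hw), hcW w hw]⟩

end Core

section Center

variable {V : Type*} [Fintype V] [DecidableEq V] {G : SimpleGraph V} [DecidableRel G.Adj] {k : ℕ}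
  {W : Finset V} {q : V}

theorem IsCenter.exists_surjective (hq : IsCenter G k W q) (hg : 9 ≤ G.egirth) (hW : W.card = k) :
    ∃ g : V → V, ∀ w ∈ W, ∃ y, g y = w ∧ G.Adj q y ∧ (y = w ∨ y ∉ W ∧ G.Adj y w) := by
  have hex : ∀ y, ∃ w, G.Adj q y → w ∈ W ∧ (y = w ∨ y ∉ W ∧ G.Adj y w) := by
    intro y
    by_cases hyW : y ∈ W
    · exact ⟨y, fun _ => ⟨hyW, Or.inl rfl⟩⟩
    by_cases hqy : G.Adj q y
    · obtain ⟨w, hw, hyw⟩ := (hq.mem_or y hqy).resolve_left hyW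
      exact ⟨w, fun _ => ⟨hw, Or.inr ⟨hyW, hyw⟩⟩⟩
    · exact ⟨y, fun h => absurd h hqy⟩
  choose g hgW using hex
  have hmaps : Set.MapsTo g (G.neighborFinset q) W := fun y hy => (hgW y (by simpa using hy)).1
  have hinj : Set.InjOn g (G.neighborFinset q) := by
    intro y hy y' hy' heq
    have hqy : G.Adj q y := by simpa using hy
    have hqy' : G.Adj q y' := by simpa using hy'
    obtain ⟨hw, h⟩ := hgW y hqy
    obtain ⟨-, h'⟩ := hgW y' hqy'
    rw [← heq] at h'
    rcases h with h | ⟨-, h⟩ <;> rcases h' with h' | ⟨-, h'⟩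
    · exact h.trans h'.symm
    · exact (false_of_closed_three hg hqy (h ▸ h'.symm) hqy'.symm).elim
    · exact (false_of_closed_three hg hqy' (h' ▸ h.symm) hqy.symm).elim
    · exact eq_of_common_neighbors hg hqy h hqy' h' (ne_of_mem_of_not_mem hw hq.notMem).symm
  have hsurj := Finset.surjOn_of_injOn_of_card_le g hmaps hinj
    (by rw [hW, G.card_neighborFinset_eq_degree, hq.degree_eq])
  refine ⟨g, fun w hw => ?_⟩
  obtain ⟨y, hy, rfl⟩ := hsurj hw
  have hqy : G.Adj q y := by simpa using hy
  exact ⟨y, rfl, hqy, (hgW y hqy).2⟩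

theorem IsCenter.exists_adj (hq : IsCenter G k W q) (hg : 9 ≤ G.egirth) (hW : W.card = k) :
    ∀ w ∈ W, ∃ y, G.Adj q y ∧ (y = w ∨ y ∉ W ∧ G.Adj y w) := fun w hw =>
  let ⟨_, h⟩ := hq.exists_surjective hg hW
  let ⟨y, hy⟩ := h w hw
  ⟨y, hy.2⟩

theorem IsCenter.not_adj (hq : IsCenter G k W q) (hg : 9 ≤ G.egirth) (hW : W.card = k) {w w' : V}
    (hw : w ∈ W) (hw' : w' ∈ W) : ¬ G.Adj w w' := by
  intro h
  obtain ⟨y, hqy, hy⟩ := hq.exists_adj hg hW w hw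
  obtain ⟨y', hqy', hy'⟩ := hq.exists_adj hg hW w' hw'
  have hqw := ne_of_mem_of_not_mem hw hq.notMem
  have hqw' := ne_of_mem_of_not_mem hw' hq.notMem
  rcases hy with rfl | ⟨hyW, hyw⟩ <;> rcases hy' with rfl | ⟨hyW', hyw'⟩
  · exact false_of_closed_three hg hqy h hqy'.symm
  · exact false_of_closed_four hg hqy h hyw'.symm hqy'.symm hqw'.symm (ne_of_mem_of_not_mem hw hyW')
  · exact false_of_closed_four hg hqy' h.symm hyw.symm hqy.symm hqw.symm
      (ne_of_mem_of_not_mem hw' hyW)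
  · exact false_of_closed_five hg hqy hyw h hyw'.symm hqy'.symm hqw.symm
      (ne_of_mem_of_not_mem hw' hyW).symm (ne_of_mem_of_not_mem hw hyW') hqw'

theorem IsCenter.eq_of_adj (hq : IsCenter G k W q) (hg : 9 ≤ G.egirth) (hW : W.card = k)
    {u w w' : V} (huq : u ≠ q) (hw : w ∈ W) (hw' : w' ∈ W) (huw : G.Adj u w)
    (huw' : G.Adj u w') : w = w' := by
  by_contra hne
  have hqw := ne_of_mem_of_not_mem hw hq.notMem
  have hqw' := ne_of_mem_of_not_mem hw' hq.notMem
  obtain ⟨f, hf⟩ := hq.exists_surjective hg hW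
  obtain ⟨y, hfy, hqy, hy⟩ := hf w hw
  obtain ⟨y', hfy', hqy', hy'⟩ := hf w' hw'
  rcases hy with rfl | ⟨hyW, hyw⟩ <;> rcases hy' with rfl | ⟨hyW', hyw'⟩
  · exact hne (hq.unique y hw y' hw' hqy hqy')
  · rcases eq_or_ne u y' with rfl | huy
    · exact false_of_closed_three hg hqy huw.symm hqy'.symm
    · exact false_of_closed_five hg hqy huw.symm huw' hyw'.symm hqy'.symm huq.symm hne huy hqw'
  · rcases eq_or_ne u y with rfl | huy
    · exact false_of_closed_three hg hqy' huw'.symm hqy.symm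
    · exact false_of_closed_five hg hqy' huw'.symm huw hyw.symm hqy.symm huq.symm (Ne.symm hne)
        huy hqw
  · rcases eq_or_ne u y with rfl | huy
    · rcases eq_or_ne u y' with rfl | huy'
      · exact hne (hfy.symm.trans hfy')
      · exact false_of_closed_four hg hqy huw' hyw'.symm hqy'.symm hqw'.symm huy'
    · rcases eq_or_ne u y' with rfl | huy'
      · exact false_of_closed_four hg hqy' huw hyw.symm hqy.symm hqw.symm huy
      · exact false_of_closed_six hg hqy hyw huw.symm huw' hyw'.symm hqy'.symm hqw.symm huy.symm hne
          huy' hqw'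

theorem IsCenter.not_adj_of_adj (hq : IsCenter G k W q) (hg : 9 ≤ G.egirth) (hW : W.card = k)
    {x x' w w' : V} (hxq : x ≠ q) (hxq' : x' ≠ q) (hx : x ∉ W) (hx' : x' ∉ W) (hw : w ∈ W)
    (hw' : w' ∈ W) (hxw : G.Adj x w) (hxw' : G.Adj x' w') : ¬ G.Adj x x' := by
  intro h
  have hqw := ne_of_mem_of_not_mem hw hq.notMem
  have hqw' := ne_of_mem_of_not_mem hw' hq.notMem
  have hwx' := ne_of_mem_of_not_mem hw hx'
  have hwx := ne_of_mem_of_not_mem hw' hx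
  obtain ⟨y, hqy, hy⟩ := hq.exists_adj hg hW w hw
  obtain ⟨y', hqy', hy'⟩ := hq.exists_adj hg hW w' hw'
  rcases hy with rfl | ⟨hyW, hyw⟩ <;> rcases hy' with rfl | ⟨hyW', hyw'⟩
  · obtain rfl := hq.unique y hw y' hw' hqy hqy'
    exact false_of_closed_three hg hxw.symm h hxw'
  · rcases eq_or_ne x' y' with rfl | hxy
    · exact false_of_closed_four hg hqy hxw.symm h hqy'.symm hxq.symm hwx'
    · exact false_of_closed_six hg hqy hxw.symm h hxw' hyw'.symm hqy'.symm hxq.symm hwx' hwx.symm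
        hxy hqw'
  · rcases eq_or_ne x y with rfl | hxy
    · exact false_of_closed_four hg hqy' hxw'.symm h.symm hqy.symm hxq'.symm hwx
    · exact false_of_closed_six hg hqy' hxw'.symm h.symm hxw hyw.symm hqy.symm hxq'.symm hwx
        hwx'.symm hxy hqw
  · rcases eq_or_ne x y with rfl | hxy <;> rcases eq_or_ne x' y' with rfl | hxy'
    · exact false_of_closed_three hg hqy h hqy'.symm
    · exact false_of_closed_five hg hqy h hxw' hyw'.symm hqy'.symm hxq'.symm hwx.symm hxy' hqw'
    · exact false_of_closed_five hg hqy' h.symm hxw hyw.symm hqy.symm hxq.symm hwx'.symm hxy hqw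
    · exact false_of_closed_seven hg hqy hyw hxw.symm h hxw' hyw'.symm hqy'.symm hqw.symm hxy.symm
        hwx' hwx.symm hxy' hqw'

theorem IsCenter.not_isCenter (hq : IsCenter G k W q) (hg : 9 ≤ G.egirth) (hW : W.card = k)
    (hk : 3 ≤ k) {x : V} (hxq : x ≠ q) (hxW : ∀ w ∈ W, ¬ G.Adj x w) : ¬ IsCenter G k W x := by
  intro hx
  obtain ⟨w₁, hw₁, w₂, hw₂, hne, hqw₁, hqw₂⟩ :
      ∃ w₁ ∈ W, ∃ w₂ ∈ W, w₁ ≠ w₂ ∧ ¬ G.Adj q w₁ ∧ ¬ G.Adj q w₂ := by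
    have h1 : (W.filter fun w => G.Adj q w).card ≤ 1 := Finset.card_le_one.2 fun a ha b hb => by
      rw [Finset.mem_filter] at ha hb
      exact hq.unique a ha.1 b hb.1 ha.2 hb.2
    have h2 := Finset.card_filter_add_card_filter_not (s := W) fun w => G.Adj q w
    obtain ⟨a, ha, b, hb, hab⟩ := Finset.one_lt_card.1
      (show 1 < (W.filter fun w => ¬ G.Adj q w).card by omega)
    rw [Finset.mem_filter] at ha hb
    exact ⟨a, ha.1, b, hb.1, hab, ha.2, hb.2⟩
  have hexq : ∀ w ∈ W, ¬ G.Adj q w → ∃ y, G.Adj q y ∧ y ∉ W ∧ G.Adj y w := fun w hw hqw => by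
    obtain ⟨y, hqy, rfl | hy⟩ := hq.exists_adj hg hW w hw
    · exact absurd hqy hqw
    · exact ⟨y, hqy, hy⟩
  have hexx : ∀ w ∈ W, ∃ y, G.Adj x y ∧ y ∉ W ∧ G.Adj y w := fun w hw => by
    obtain ⟨y, hqy, rfl | hy⟩ := hx.exists_adj hg hW w hw
    · exact absurd hqy (hxW y hw)
    · exact ⟨y, hqy, hy⟩
  obtain ⟨y₁, hqy₁, hyW₁, hyw₁⟩ := hexq w₁ hw₁ hqw₁
  obtain ⟨y₂, hqy₂, hyW₂, hyw₂⟩ := hexq w₂ hw₂ hqw₂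
  obtain ⟨x₁, hxx₁, hxW₁, hxw₁⟩ := hexx w₁ hw₁
  obtain ⟨x₂, hxx₂, hxW₂, hxw₂⟩ := hexx w₂ hw₂
  have hy : y₁ ≠ y₂ := by
    rintro rfl
    exact hne (hq.eq_of_adj hg hW hqy₁.ne' hw₁ hw₂ hyw₁ hyw₂)
  have hx' : x₁ ≠ x₂ := by
    rintro rfl
    exact hne (hx.eq_of_adj hg hW hxx₁.ne' hw₁ hw₂ hxw₁ hxw₂)
  have hw₁q := ne_of_mem_of_not_mem hw₁ hq.notMem
  have hw₂q := ne_of_mem_of_not_mem hw₂ hq.notMem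
  have hw₁x := ne_of_mem_of_not_mem hw₁ hx.notMem
  have hw₂x := ne_of_mem_of_not_mem hw₂ hx.notMem
  rcases eq_or_ne y₁ x₁ with rfl | h₁ <;> rcases eq_or_ne y₂ x₂ with rfl | h₂
  · exact false_of_closed_four hg hqy₁ hxx₁.symm hxx₂ hqy₂.symm hxq.symm hy
  · exact false_of_closed_six hg hqy₁ hxx₁.symm hxx₂ hxw₂ hyw₂.symm hqy₂.symm hxq.symm hx' hw₂x.symm
      h₂.symm hw₂q
  · exact false_of_closed_six hg hqy₁ hyw₁ hxw₁.symm hxx₁.symm hxx₂ hqy₂.symm hw₁q.symm h₁ hw₁x hx'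
      hxq
  · exact false_of_closed_eight hg hqy₁ hyw₁ hxw₁.symm hxx₁.symm hxx₂ hxw₂ hyw₂.symm hqy₂.symm
      hw₁q.symm h₁ hw₁x hx' hw₂x.symm h₂.symm hw₂q

theorem IsBasis.exists_isBColoring_of_isCenter (h : IsBasis G k W) (hg : 9 ≤ G.egirth)
    (hq : IsCenter G k W q) : ∃ C : V → Fin k, IsBColoring G k C := by
  have hk := h.three_le
  have hW := h.card_eq
  obtain ⟨c₀, -, hsurj⟩ := exists_bijective_coloring hW (by omega)
  let D : Finset V := Finset.univ.filter fun v =>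
    v ∉ W ∧ (v ∈ ({q} : Finset V) ∨ ∃ w ∈ W, G.Adj v w)
  have hD : ∀ v, v ∈ D ↔ v ∉ W ∧ (v ∈ ({q} : Finset V) ∨ ∃ w ∈ W, G.Adj v w) := fun v => by simp [D]
  obtain ⟨α, hα⟩ : ∃ α, ∀ v ∈ W.filter fun w => G.Adj q w, c₀ v ≠ α := by
    refine exists_notMem_image_of_card_lt (lt_of_le_of_lt (Finset.card_le_one.2 ?_)
      (by omega : 1 < k))
    intro a ha b hb
    rw [Finset.mem_filter] at ha hb
    exact hq.unique a ha.1 b hb.1 ha.2 hb.2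
  have hc : ProperOn G (Function.update c₀ q α) (W ∪ {q}) := by
    rw [Finset.union_comm, ← Finset.insert_eq]
    exact ProperOn.update (fun u hu v hv huv => absurd huv (hq.not_adj hg hW hu hv))
      fun u hu hqu => hα u (Finset.mem_filter.2 ⟨hu, hqu⟩)
  have hP : ∀ {w y}, y ∈ G.neighborFinset w \ (W ∪ {q}) → G.Adj w y ∧ y ∉ W ∧ y ≠ q := by
    intro w y hy
    simpa [and_comm] using hy
  have hPcard : ∀ w ∈ W, k ≤ 1 + (G.neighborFinset w \ (W ∪ {q})).card := by
    intro w hw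
    have h1 : (G.neighborFinset w ∩ (W ∪ {q})).card ≤ 1 := by
      rw [← Finset.card_singleton q]
      refine Finset.card_le_card fun v hv => ?_
      simp only [Finset.mem_inter, SimpleGraph.mem_neighborFinset, Finset.mem_union] at hv
      exact hv.2.resolve_left fun hvW => hq.not_adj hg hW hw hvW hv.1
    have h2 := Finset.card_inter_add_card_sdiff (G.neighborFinset w) (W ∪ {q})
    have h3 := h.le_degree w hw
    rw [G.card_neighborFinset_eq_degree] at h2
    omega
  have hPD : ∀ w ∈ W, ∀ y ∈ G.neighborFinset w \ (W ∪ {q}),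
      (G.neighborFinset y ∩ D).card ≤ if G.Adj y q then 1 else 0 := by
    intro w hw y hy
    obtain ⟨hwy, hyW, hyq⟩ := hP hy
    have hsub : ∀ z ∈ G.neighborFinset y ∩ D, z = q ∧ G.Adj y q := by
      intro z hz
      rw [Finset.mem_inter, SimpleGraph.mem_neighborFinset, hD, Finset.mem_singleton] at hz
      obtain ⟨hyz, hzW, hz⟩ := hz
      by_cases hzq : z = q
      · exact ⟨hzq, hzq ▸ hyz⟩
      · obtain ⟨w', hw', hzw'⟩ := hz.resolve_left hzq
        exact absurd hyz (hq.not_adj_of_adj hg hW hyq hzq hyW hzW hw hw' hwy.symm hzw')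
    split_ifs with hyq'
    · rw [← Finset.card_singleton q]
      exact Finset.card_le_card fun z hz => Finset.mem_singleton.2 (hsub z hz).1
    · exact (Finset.card_eq_zero.2 (Finset.eq_empty_of_forall_notMem fun z hz =>
        hyq' (hsub z hz).2)).le
  have huniq : ∀ v, v ∉ W ∪ {q} → ∀ w ∈ W, ∀ w' ∈ W, G.Adj v w → G.Adj v w' → w = w' := by
    intro v hv w hw w' hw' hvw hvw'
    rw [Finset.mem_union, not_or, Finset.mem_singleton] at hv
    exact hq.eq_of_adj hg hW hv.2 hw hw' hvw hvw'
  obtain ⟨c, hc', hag, hdom⟩ := exists_dominating_coloring hg hD hc huniq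
    (fun w hw => by have := hPcard w hw; omega)
    (fun w hw => by
      have h1 := hPcard w hw
      have h2 := Finset.sum_le_sum (hPD w hw)
      rw [← Finset.card_filter] at h2
      have h3 : ((G.neighborFinset w \ (W ∪ {q})).filter fun y => G.Adj y q).card ≤ 1 := by
        refine Finset.card_le_one.2 fun a ha b hb => ?_
        rw [Finset.mem_filter] at ha hb
        exact eq_of_common_neighbors hg (hP ha.1).1 ha.2 (hP hb.1).1 hb.2
          (ne_of_mem_of_not_mem hw hq.notMem)
      omega)
    (fun w hw y hy => by
      have h1 := hPD w hw y hy
      split_ifs at h1 <;> omega)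
  refine h.exists_isBColoring_of_dominating hg hD (fun q' hq' => Or.inr ?_) (fun x hx => ?_) hc'
    (fun i => ?_) hdom
  · rwa [Finset.mem_singleton.1 hq']
  · rw [Finset.mem_union, not_or, hD, not_and_or, not_not, not_or, Finset.mem_singleton] at hx
    obtain ⟨hxq, hxW⟩ := hx.2.resolve_left hx.1
    exact hq.not_isCenter hg hW hk hxq fun w hw hxw => hxW ⟨w, hw, hxw⟩
  · obtain ⟨w, hw, rfl⟩ := hsurj i
    refine ⟨w, hw, ?_⟩
    rw [hag w (Finset.mem_union_left _ hw),
      Function.update_of_ne (ne_of_mem_of_not_mem hw hq.notMem)]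

theorem IsBasis.exists_isBColoring (h : IsBasis G k W) (hg : 9 ≤ G.egirth) :
    ∃ C : V → Fin k, IsBColoring G k C := by
  by_cases hq : ∃ q, IsCenter G k W q
  · obtain ⟨q, hq⟩ := hq
    exact h.exists_isBColoring_of_isCenter hg hq
  · exact h.exists_isBColoring_of_forall_not_isCenter hg (not_exists.1 hq)

end Center

section Bounds

variable {V : Type*} [Fintype V] {G : SimpleGraph V} {k n : ℕ}

theorem IsBColoring.le_card [DecidableRel G.Adj] {C : V → Fin k} (hC : IsBColoring G k C) :
    k ≤ (Finset.univ.filter fun v => k - 1 ≤ G.degree v).card := by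
  classical
  choose u hu hub using hC.2
  have hinj : Function.Injective u := fun i j hij => by rw [← hu i, ← hu j, hij]
  calc k = (Finset.univ.image u).card := by
        rw [Finset.card_image_of_injective _ hinj, Finset.card_univ, Fintype.card_fin]
    _ ≤ _ := Finset.card_le_card fun v hv => by
        obtain ⟨i, -, rfl⟩ := Finset.mem_image.1 hv
        refine Finset.mem_filter.2 ⟨Finset.mem_univ _, ?_⟩
        have hsub : Finset.univ.erase i ⊆ (G.neighborFinset (u i)).image C := fun j hj => by
          obtain ⟨w, hw, hwj⟩ := hub i j (by rw [hu]; exact Finset.ne_of_mem_erase hj)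
          exact Finset.mem_image.2 ⟨w, by simpa using hw, hwj⟩
        have h1 := (Finset.card_le_card hsub).trans Finset.card_image_le
        rwa [Finset.card_erase_of_mem (Finset.mem_univ _), Finset.card_univ, Fintype.card_fin,
          G.card_neighborFinset_eq_degree] at h1

theorem bddAbove_mParam (G : SimpleGraph V) [DecidableRel G.Adj] :
    BddAbove {k : ℕ | k ≤ (Finset.univ.filter fun v => k - 1 ≤ G.degree v).card} :=
  ⟨Fintype.card V, fun _ hk => hk.trans (Finset.card_le_univ _)⟩

theorem le_mParam [DecidableRel G.Adj]
    (h : k ≤ (Finset.univ.filter fun v => k - 1 ≤ G.degree v).card) : k ≤ mParam G :=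
  le_csSup (bddAbove_mParam G) h

theorem mParam_le_card (G : SimpleGraph V) [DecidableRel G.Adj] :
    mParam G ≤ (Finset.univ.filter fun v => mParam G - 1 ≤ G.degree v).card :=
  Nat.sSup_mem (s := {k : ℕ | k ≤ (Finset.univ.filter fun v => k - 1 ≤ G.degree v).card})
    ⟨0, Nat.zero_le _⟩ (bddAbove_mParam G)

theorem IsBColoring.le_bChromatic {C : V → Fin k} (hC : IsBColoring G k C) :
    k ≤ bChromatic G := by
  classical
  exact le_csSup ⟨Fintype.card V, fun _ ⟨_, hD⟩ => hD.le_card.trans (Finset.card_le_univ _)⟩ ⟨C, hC⟩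

theorem bChromatic_le_mParam (G : SimpleGraph V) [DecidableRel G.Adj] :
    bChromatic G ≤ mParam G :=
  csSup_le' fun _ ⟨_, hC⟩ => le_mParam hC.le_card

/-- A proper coloring with the least possible number of colors is a b-coloring. -/
theorem isBColoring_of_not_colorable (C : G.Coloring (Fin (k + 1))) (hk : ¬ G.Colorable k) :
    IsBColoring G (k + 1) C := by
  classical
  refine ⟨fun u v huv => C.valid huv, fun i => ?_⟩
  by_contra! hi
  have hfree : ∀ u, ∃ j, C u = i → j ≠ i ∧ ∀ w, G.Adj u w → C w ≠ j := by
    intro u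
    by_cases hu : C u = i
    · have := hi u hu
      simp only [IsBVertex, not_forall, not_exists, not_and] at this
      obtain ⟨j, hj, h⟩ := this
      exact ⟨j, fun _ => ⟨hu ▸ hj, h⟩⟩
    · exact ⟨i, fun h => absurd h hu⟩
  choose f hf using hfree
  let C' : G.Coloring {x : Fin (k + 1) // x ≠ i} := SimpleGraph.Coloring.mk
    (fun u => if h : C u = i then ⟨f u, (hf u h).1⟩ else ⟨C u, h⟩) fun {u v} huv => by
      have hne := C.valid huv
      by_cases hu : C u = i <;> by_cases hv : C v = i
      · exact absurd (hu.trans hv.symm) hne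
      · simpa [hu, hv] using ((hf u hu).2 v huv).symm
      · simpa [hu, hv] using (hf v hv).2 u huv.symm
      · simpa [hu, hv] using hne
  refine hk ?_
  have := C'.colorable
  rwa [Fintype.card_subtype_compl, Fintype.card_subtype_eq, Fintype.card_fin,
    Nat.add_sub_cancel] at this

theorem lt_bChromatic_of_not_colorable (hn : ¬ G.Colorable n) : n < bChromatic G := by
  classical
  have hex : ∃ k, G.Colorable k := ⟨_, G.colorable_of_fintype⟩
  obtain ⟨k, hk⟩ : ∃ k, Nat.find hex = k + 1 := Nat.exists_eq_succ_of_ne_zero fun h0 =>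
    hn ((h0 ▸ Nat.find_spec hex : G.Colorable 0).mono (Nat.zero_le n))
  have hcol : G.Colorable (k + 1) := hk ▸ Nat.find_spec hex
  have h1 := (isBColoring_of_not_colorable hcol.some
    (Nat.find_min hex (by omega))).le_bChromatic
  have h2 : n < k + 1 := not_le.1 fun h => hn (hcol.mono h)
  omega

theorem three_le_bChromatic_of_path (hg : 9 ≤ G.egirth) {a b c d e : V} (hab : G.Adj a b)
    (hbc : G.Adj b c) (hcd : G.Adj c d) (hde : G.Adj d e) (hac : a ≠ c) (hbd : b ≠ d)
    (hce : c ≠ e) : 3 ≤ bChromatic G := by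
  classical
  by_cases hcol : G.Colorable 2
  swap
  · exact lt_bChromatic_of_not_colorable hcol
  obtain ⟨s⟩ := hcol
  have hae : a ≠ e := by
    rintro rfl
    exact false_of_closed_four hg hab hbc hcd hde hac hbd
  have hbe : ¬ G.Adj b e := fun h => false_of_closed_four hg hbc hcd hde h.symm hbd hce
  have htwo : ∀ {x y z : V}, G.Adj x y → (s y = s z ↔ s x ≠ s z) := fun {x y z} h => by
    have := s.valid h
    omega
  have hb : s b ≠ s c := (s.valid hbc)
  have ha : s a = s c := by
    have := s.valid hab
    omega
  have hd : s d ≠ s c := (s.valid hcd).symm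
  have he : s e = s c := by
    have := s.valid hde
    omega
  let C : V → Fin 3 := fun v =>
    if s v = s c then if v = a then 2 else if v = e then 0 else 1
    else if G.Adj v e then 2 else 0
  have hside : ∀ u v, G.Adj u v → s u = s c → s v ≠ s c → C u ≠ C v := by
    intro u v huv hu hv
    by_cases hua : u = a
    · subst hua
      have hve : ¬ G.Adj v e := fun hve => by
        by_cases hvd : d = v
        · subst hvd
          exact false_of_closed_four hg hab hbc hcd huv.symm hac hbd
        · exact false_of_closed_six hg hab hbc hcd hde hve.symm huv.symm hac hbd hce hvd hae.symm
      simp [C, hv, hve, ha]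
    by_cases hue : u = e
    · subst hue
      simp [C, hv, huv.symm, hu, hua]
    · simp only [C, hu, hv, hua, hue, if_true, if_false]
      split_ifs <;> decide
  have hCb : C b = 0 := by simp [C, hb, hbe]
  have hCc : C c = 1 := by simp [C, hac.symm, hce]
  have hCd : C d = 2 := by simp [C, hd, hde]
  have hCa : C a = 2 := by simp [C, ha]
  have hCe : C e = 0 := by simp [C, he, hae.symm]
  refine IsBColoring.le_bChromatic (C := C) ⟨fun u v huv => ?_, fun i => ?_⟩
  · have hne := s.valid huv
    by_cases hu : s u = s c
    · exact hside u v huv hu fun hv => hne (hu.trans hv.symm)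
    · exact (hside v u huv.symm (by omega) hu).symm
  · fin_cases i
    · refine ⟨b, hCb, fun j hj => ?_⟩
      fin_cases j
      · exact absurd hCb.symm hj
      · exact ⟨c, hbc, hCc⟩
      · exact ⟨a, hab.symm, hCa⟩
    · refine ⟨c, hCc, fun j hj => ?_⟩
      fin_cases j
      · exact ⟨b, hbc.symm, hCb⟩
      · exact absurd hCc.symm hj
      · exact ⟨d, hcd, hCd⟩
    · refine ⟨d, hCd, fun j hj => ?_⟩
      fin_cases j
      · exact ⟨e, hde, hCe⟩
      · exact ⟨c, hcd.symm, hCc⟩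
      · exact absurd hCd.symm hj

theorem exists_isBasis [DecidableEq V] [DecidableRel G.Adj] (hg : 9 ≤ G.egirth) {W : Finset V}
    (hW : W.card = k) (hk : 3 ≤ k) (hdeg : ∀ w ∈ W, k ≤ G.degree w)
    (hdeg' : ∀ v ∉ W, G.degree v ≤ k)
    (h4 : 4 ≤ k ∨ 2 ≤ k ∧ ∀ x, k ≤ G.degree x → ∃ y, G.Adj x y ∧ ∀ z, G.Adj y z → z = x) :
    ∃ W' : Finset V, IsBasis G k W' := by
  by_cases hu : ∃ u ∉ W, ∀ w ∈ W, G.Adj u w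
  swap
  · push Not at hu
    exact ⟨W, hW, hk, hdeg, hu, fun v hv hlt => absurd (hdeg' v hv) (by omega), h4⟩
  obtain ⟨u, huW, hu⟩ := hu
  obtain ⟨w₀, hw₀, w₁, hw₁, hne⟩ := Finset.one_lt_card.1 (show 1 < W.card by omega)
  have hw₁' : w₁ ∈ insert u (W.erase w₀) :=
    Finset.mem_insert_of_mem (Finset.mem_erase.2 ⟨hne.symm, hw₁⟩)
  refine ⟨insert u (W.erase w₀), ?_, hk, fun w hw => ?_, fun v hv => ?_, fun v hv hlt => ?_, h4⟩
  · rw [Finset.card_insert_of_notMem fun h => huW (Finset.mem_of_mem_erase h),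
      Finset.card_erase_of_mem hw₀]
    omega
  · rcases Finset.mem_insert.1 hw with rfl | hw
    · rw [← hW, ← G.card_neighborFinset_eq_degree]
      exact Finset.card_le_card fun w hw => by simpa using hu w hw
    · exact hdeg w (Finset.mem_of_mem_erase hw)
  · by_contra! hall
    exact false_of_closed_three hg (hall u (Finset.mem_insert_self _ _)) (hu w₁ hw₁)
      (hall w₁ hw₁').symm
  · have hvW : v ∈ W := by
      by_contra hvW
      exact absurd (hdeg' v hvW) (by omega)
    exact ⟨u, Finset.mem_insert_self _ _, w₁, hw₁', (hu v hvW).symm, hu w₁ hw₁⟩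

theorem le_bChromatic_of_card_eq [DecidableRel G.Adj] (hg : 9 ≤ G.egirth) {W : Finset V}
    (hW : W.card = k) (hk : 3 ≤ k) (hdeg : ∀ w ∈ W, k ≤ G.degree w)
    (hdeg' : ∀ v ∉ W, G.degree v ≤ k) : k ≤ bChromatic G := by
  classical
  by_cases h4 : 4 ≤ k ∨ 2 ≤ k ∧ ∀ x, k ≤ G.degree x → ∃ y, G.Adj x y ∧ ∀ z, G.Adj y z → z = x
  · obtain ⟨W', hW'⟩ := exists_isBasis hg hW hk hdeg hdeg' h4
    obtain ⟨C, hC⟩ := hW'.exists_isBColoring hg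
    exact hC.le_bChromatic
  · push Not at h4
    obtain ⟨h4, hx⟩ := h4
    obtain ⟨x, hx, hxy⟩ := hx (by omega)
    obtain ⟨b, hb, d, hd, hbd⟩ := Finset.one_lt_card.1
      (show 1 < (G.neighborFinset x).card by rw [G.card_neighborFinset_eq_degree]; omega)
    rw [SimpleGraph.mem_neighborFinset] at hb hd
    obtain ⟨a, hba, hax⟩ := hxy b hb
    obtain ⟨e, hde, hex⟩ := hxy d hd
    have := three_le_bChromatic_of_path hg hba.symm hb.symm hd hde hax hbd hex.symm
    omega

end Bounds

/-- If `G` has girth at least 9, then `m(G) - 1 ≤ χ_b(G) ≤ m(G)`. -/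
theorem bChromatic_bounds_of_girth_ge_nine {V : Type*} [Fintype V] (G : SimpleGraph V)
    [DecidableRel G.Adj] (hg : 9 ≤ G.egirth) :
    mParam G - 1 ≤ bChromatic G ∧ bChromatic G ≤ mParam G := by
  refine ⟨?_, bChromatic_le_mParam G⟩
  have hcard := mParam_le_card G
  have hlt : (Finset.univ.filter fun v => mParam G ≤ G.degree v).card < mParam G + 1 :=
    not_le.1 fun h => absurd (le_mParam (k := mParam G + 1) h) (by omega)
  set m := mParam G
  rcases le_or_gt m 1 with h1 | h1
  · omega
  rcases le_or_gt m 3 with h3 | h3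
  · obtain ⟨v, hv⟩ := Finset.card_pos.1 (h1.le.trans hcard)
    have hv' := (Finset.mem_filter.1 hv).2
    obtain ⟨w, hw⟩ := (G.degree_pos_iff_exists_adj v).1 (by omega)
    have := lt_bChromatic_of_not_colorable (G := G) (n := 1)
      fun ⟨C⟩ => C.valid hw (Subsingleton.elim _ _)
    omega
  rcases (Nat.lt_succ_iff.1 hlt).eq_or_lt with heq | hlt
  · have := le_bChromatic_of_card_eq hg heq (by omega) (fun w hw => (Finset.mem_filter.1 hw).2)
      fun v hv => le_of_not_ge fun h => hv (Finset.mem_filter.2 ⟨Finset.mem_univ _, h⟩)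
    omega
  · obtain ⟨W, hDW, hWM, hW⟩ := Finset.exists_subsuperset_card_eq
      (Finset.monotone_filter_right Finset.univ fun v _ (h : m ≤ G.degree v) =>
        (by omega : m - 1 ≤ G.degree v)) (n := m - 1) (by omega) (by omega)
    refine le_bChromatic_of_card_eq hg hW (by omega) (fun w hw => (Finset.mem_filter.1 (hWM hw)).2)
      fun v hv => ?_
    by_contra! hlt'
    exact hv (hDW (Finset.mem_filter.2 ⟨Finset.mem_univ _, by omega⟩))
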